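/- arXiv:2105.09635 — 4 statements merged into one kernel-verified Lean document; each statement's English description precedes it below -/
import Mathlib

section
/- Let P ⊂ ℝ⁴ be a 4-dimensional canonical lattice simplex. Then mult(P) ≤ 128, with equality if and only if P is unimodularly equivalent to conv{0, 2e_1, 8e_2, 8e_3, 8e_4} − (1,1,1,1). -/
/-- The canonical embedding of integer vectors into real vectors. -/
def toR {d : ℕ} (x : Fin d → ℤ) : Fin d → ℝ := fun j => (x j : ℝ)

/-- The lattice simplex (as a subset of `ℝ^d`) with vertex family `v`. -/
def hullOf {d : ℕ} (v : Fin (d + 1) → Fin d → ℤ) : Set (Fin d → ℝ) :=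
  convexHull ℝ (Set.range fun i => toR (v i))

/-- `v` is the vertex family of a `d`-dimensional canonical lattice simplex:
the vertices are affinely independent lattice points, the origin lies in the
interior, and the origin is the only lattice point in the interior. -/
def IsCanonicalSimplex {d : ℕ} (v : Fin (d + 1) → Fin d → ℤ) : Prop :=
  AffineIndependent ℝ (fun i => toR (v i)) ∧
  (0 : Fin d → ℝ) ∈ interior (hullOf v) ∧
  ∀ x : Fin d → ℤ, toR x ∈ interior (hullOf v) → x = 0

/-- The multiplicity of the lattice simplex with vertex family `v`: the index in
`ℤ^d` of the subgroup generated by the vertices. -/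
noncomputable def mult {d : ℕ} (v : Fin (d + 1) → Fin d → ℤ) : ℕ :=
  (AddSubgroup.closure (Set.range v)).index

/-- Two subsets of `ℝ^d` are unimodularly equivalent if one is the image of the
other under `x ↦ A x + w` with `A ∈ GL_d(ℤ)` and `w ∈ ℤ^d`. -/
def UnimodEquiv {d : ℕ} (Q Q' : Set (Fin d → ℝ)) : Prop :=
  ∃ (A : Matrix (Fin d) (Fin d) ℤ) (w : Fin d → ℤ), IsUnit A.det ∧
    Q' = (fun x => (A.map fun n : ℤ => (n : ℝ)).mulVec x + toR w) '' Q

/-- The vertex family of the simplex `conv{0, 2 e_1, 8 e_2, 8 e_3, 8 e_4} - (1,1,1,1)`. -/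
def dim4V : Fin 5 → Fin 4 → ℤ := fun i j =>
  (if (j : ℕ) + 1 = (i : ℕ) then (if (i : ℕ) = 1 then 2 else 8) else 0) - 1

open Matrix

theorem index_closure_range_rows {n : ℕ} (A : Matrix (Fin n) (Fin n) ℤ) (hA : A.det ≠ 0) :
    (AddSubgroup.closure (Set.range A.row)).index = A.det.natAbs := by
  have hli : LinearIndependent ℤ A := Matrix.linearIndependent_rows_of_det_ne_zero hA
  have hspan : (Submodule.span ℤ (Set.range A.row)).toAddSubgroup =
      AddSubgroup.closure (Set.range A.row) := Submodule.span_int_eq_addSubgroupClosure _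
  rw [← hspan, AddSubgroup.index_eq_natAbs_det (Pi.basisFun ℤ (Fin n)) _
    (Module.Basis.span hli)]
  have hc : (fun i => ((Module.Basis.span hli i : Submodule.span ℤ (Set.range A.row)) : Fin n → ℤ))
      = A.row := by
    funext i
    exact congrArg Subtype.val (Module.Basis.span_apply hli i)
  have := Pi.basisFun_det_apply (R := ℤ) A
  exact congrArg Int.natAbs ((congrArg _ hc).trans this)

theorem mem_closure_range_rows {n : ℕ} (A : Matrix (Fin n) (Fin n) ℤ) (x : Fin n → ℤ) :
    x ∈ AddSubgroup.closure (Set.range A.row) ↔ ∃ z, z ᵥ* A = x := by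
  have hspan : (Submodule.span ℤ (Set.range A.row)).toAddSubgroup =
      AddSubgroup.closure (Set.range A.row) := Submodule.span_int_eq_addSubgroupClosure _
  rw [← hspan, Submodule.mem_toAddSubgroup, Submodule.mem_span_range_iff_exists_fun]
  exact exists_congr fun z => by rw [Matrix.vecMul_eq_sum]; rfl

/-- A finite set of integer points that are pairwise incongruent modulo the row lattice of `A`
has at most `|det A|` elements, and meets the lattice if it has exactly that many. -/
theorem card_le_natAbs_det_of_incongruent {n : ℕ} (A : Matrix (Fin n) (Fin n) ℤ)
    (hA : A.det ≠ 0) (S : Finset (Fin n → ℤ))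
    (hS : ∀ x ∈ S, ∀ y ∈ S, (∃ z, z ᵥ* A = x - y) → x = y) :
    S.card ≤ A.det.natAbs ∧ (S.card = A.det.natAbs → ∃ s ∈ S, ∃ z, z ᵥ* A = s) := by
  set H := AddSubgroup.closure (Set.range A.row) with hH
  have hidx : H.index = A.det.natAbs := index_closure_range_rows A hA
  have hcard : Nat.card ((Fin n → ℤ) ⧸ H) = A.det.natAbs := hidx
  have : Finite ((Fin n → ℤ) ⧸ H) :=
    Nat.finite_of_card_ne_zero (by rw [hcard]; exact Int.natAbs_ne_zero.2 hA)
  let f : S → (Fin n → ℤ) ⧸ H := fun s => QuotientAddGroup.mk s.1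
  have hf : Function.Injective f := by
    intro x y hxy
    have h1 : -y.1 + x.1 ∈ H := QuotientAddGroup.eq.1 hxy.symm
    rw [hH, mem_closure_range_rows] at h1
    exact Subtype.ext (hS _ x.2 _ y.2 (by rwa [sub_eq_neg_add]))
  have hS' : Nat.card S = S.card := by simp
  refine ⟨by rw [← hS', ← hcard]; exact Nat.card_le_card_of_injective f hf, fun h => ?_⟩
  have hbij : Function.Bijective f :=
    (Nat.bijective_iff_injective_and_card f).2 ⟨hf, by rw [hS', hcard, h]⟩
  obtain ⟨s, hs⟩ := hbij.2 (QuotientAddGroup.mk 0)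
  have h1 : -0 + s.1 ∈ H := QuotientAddGroup.eq.1 hs.symm
  rw [hH, mem_closure_range_rows] at h1
  exact ⟨s.1, s.2, by simpa using h1⟩

theorem one_le_of_weight_bounds {a b c d e : ℝ} (hs : a + b + c + d + e = 1) (ha : a ≤ 1 / 2)
    (hb : b ≤ 1 / 3) (hab : b ≤ a) (hbc : c ≤ b) (hcd : d ≤ c) (hde : e ≤ d) (he : 0 < e) :
    1 ≤ 128 * (a * b * c) ∧
      (128 * (a * b * c) = 1 → a = 1 / 2 ∧ b = 1 / 8 ∧ c = 1 / 8 ∧ d = 1 / 8 ∧ e = 1 / 8) := by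
  have h1 : 0 ≤ (1 - 2 * a) * (6 * a - 1 - 4 * a ^ 2) :=
    mul_nonneg (by linarith) (by nlinarith)
  have h2 : 0 ≤ (b - (1 - a) / 4) * (3 * (1 - a) / 4 - b) :=
    mul_nonneg (by linarith) (by linarith)
  have h2' : 0 ≤ a * ((b - (1 - a) / 4) * (3 * (1 - a) / 4 - b)) :=
    mul_nonneg (by linarith) h2
  have h3 : 0 ≤ a * b * (3 * c - (1 - a - b)) :=
    mul_nonneg (mul_nonneg (by linarith) (by linarith)) (by linarith)
  have key : 3 * (128 * (a * b * c) - 1) = 3 * ((1 - 2 * a) * (6 * a - 1 - 4 * a ^ 2)) +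
      128 * (a * ((b - (1 - a) / 4) * (3 * (1 - a) / 4 - b))) +
      128 * (a * b * (3 * c - (1 - a - b))) := by ring
  refine ⟨by linarith, fun h => ?_⟩
  have e1 : (1 - 2 * a) * (6 * a - 1 - 4 * a ^ 2) = 0 := by linarith
  have ea : a = 1 / 2 := by
    rcases mul_eq_zero.1 e1 with h | h
    · linarith
    · nlinarith
  have e2 : a * ((b - (1 - a) / 4) * (3 * (1 - a) / 4 - b)) = 0 := by linarith
  have e3 : a * b * (3 * c - (1 - a - b)) = 0 := by linarith
  subst ea
  have eb : b = 1 / 8 := by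
    rcases mul_eq_zero.1 e2 with h | h
    · norm_num at h
    rcases mul_eq_zero.1 h with h | h <;> linarith
  subst eb
  have ec : c = 1 / 8 := by
    rcases mul_eq_zero.1 e3 with h | h
    · norm_num at h
    linarith
  refine ⟨rfl, rfl, ec, by linarith, by linarith⟩

theorem exists_affineBasis {d : ℕ} {v : Fin (d + 1) → Fin d → ℤ}
    (hv : AffineIndependent ℝ fun i => toR (v i)) :
    ∃ B : AffineBasis (Fin (d + 1)) ℝ (Fin d → ℝ), ⇑B = fun i => toR (v i) := by
  have htop : affineSpan ℝ (Set.range fun i => toR (v i)) = ⊤ := by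
    rw [hv.affineSpan_eq_top_iff_card_eq_finrank_add_one]
    simp
  exact ⟨⟨fun i => toR (v i), hv, htop⟩, rfl⟩

theorem mem_interior_hullOf_iff {d : ℕ} {v : Fin (d + 1) → Fin d → ℤ}
    (hv : AffineIndependent ℝ fun i => toR (v i)) (p : Fin d → ℝ) :
    p ∈ interior (hullOf v) ↔
      ∃ w : Fin (d + 1) → ℝ, (∀ i, 0 < w i) ∧ ∑ i, w i = 1 ∧ ∑ i, w i • toR (v i) = p := by
  obtain ⟨B, hBv⟩ := exists_affineBasis hv
  have hB : interior (hullOf v) = {x | ∀ i, 0 < B.coord i x} := by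
    rw [hullOf, ← hBv, B.interior_convexHull]
  rw [hB, Set.mem_ofPred_eq]
  constructor
  · intro h
    refine ⟨fun i => B.coord i p, h, B.sum_coord_apply_eq_one p, ?_⟩
    have := B.linear_combination_coord_eq_self p
    rwa [hBv] at this
  · rintro ⟨w, hw, hw1, rfl⟩ i
    have h1 : (Finset.univ.affineCombination ℝ B w) = ∑ i, w i • toR (v i) := by
      rw [hBv]
      exact Finset.affineCombination_eq_linear_combination _ _ _ hw1
    rw [← h1, B.coord_apply_combination_of_mem (Finset.mem_univ i) hw1]
    exact hw i

theorem AffineIndependent.weights_eq {ι V : Type*} [Fintype ι] [AddCommGroup V] [Module ℝ V]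
    {p : ι → V} (hp : AffineIndependent ℝ p) {w w' : ι → ℝ} (h : ∑ i, w i = ∑ i, w' i)
    (h' : ∑ i, w i • p i = ∑ i, w' i • p i) : w = w' := by
  rw [affineIndependent_iff] at hp
  funext i
  have := hp Finset.univ (fun i => w i - w' i) (by simp [h]) (by simp [sub_smul, h']) i
    (Finset.mem_univ i)
  linarith

theorem IsCanonicalSimplex.exists_weights {d : ℕ} {v : Fin (d + 1) → Fin d → ℤ}
    (hv : IsCanonicalSimplex v) :
    ∃ β : Fin (d + 1) → ℝ, (∀ i, 0 < β i) ∧ ∑ i, β i = 1 ∧ ∑ i, β i • toR (v i) = 0 :=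
  (mem_interior_hullOf_iff hv.1 0).1 hv.2.1

theorem IsCanonicalSimplex.weights_eq {d : ℕ} {v : Fin (d + 1) → Fin d → ℤ}
    (hv : IsCanonicalSimplex v) {β : Fin (d + 1) → ℝ} (hβ : ∑ i, β i = 1)
    (hβv : ∑ i, β i • toR (v i) = 0) {w : Fin (d + 1) → ℝ} (hw : ∀ i, 0 < w i)
    (hw1 : ∑ i, w i = 1) (x : Fin d → ℤ) (hx : ∑ i, w i • toR (v i) = toR x) : w = β := by
  have h0 : x = 0 := hv.2.2 x ((mem_interior_hullOf_iff hv.1 _).2 ⟨w, hw, hw1, hx⟩)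
  apply hv.1.weights_eq (hw1.trans hβ.symm)
  rw [hx, hβv, h0]
  ext j
  simp [toR]

/-- The matrix whose rows are the edge vectors of the simplex at its last vertex. -/
def edgeMatrix {d : ℕ} (v : Fin (d + 1) → Fin d → ℤ) : Matrix (Fin d) (Fin d) ℤ :=
  fun i => v i.castSucc - v (Fin.last d)

theorem edgeMatrix_det_ne_zero {d : ℕ} {v : Fin (d + 1) → Fin d → ℤ}
    (hv : AffineIndependent ℝ fun i => toR (v i)) : (edgeMatrix v).det ≠ 0 := by
  intro h
  obtain ⟨c, hc, hcD⟩ := Matrix.exists_vecMul_eq_zero_iff.2 h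
  apply hc
  have key : (Fin.snoc (fun i => (c i : ℝ)) (-∑ i, (c i : ℝ)) : Fin (d + 1) → ℝ) = 0 := by
    apply hv.weights_eq
    · simp [Fin.sum_univ_castSucc]
    · ext j
      have := congrFun hcD j
      simp only [vecMul, dotProduct, edgeMatrix, Pi.sub_apply, mul_sub, Finset.sum_sub_distrib,
        Pi.zero_apply] at this
      have h2 : (∑ i, (c i : ℝ) * (v i.castSucc j : ℝ)) - ∑ i, (c i : ℝ) * (v (Fin.last d) j) = 0 := by
        exact_mod_cast this
      simp only [Fin.sum_univ_castSucc, Fin.snoc_castSucc, Fin.snoc_last,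
        Finset.sum_apply, Pi.smul_apply, smul_eq_mul, toR, neg_mul, Finset.sum_mul, Pi.zero_apply,
        zero_mul, Finset.sum_const_zero]
      linarith
  funext i
  have := congrFun key i.castSucc
  simpa using this

/-- The matrix of the `|det|`-scaled barycentric coordinates. -/
def coordMatrix {d : ℕ} (v : Fin (d + 1) → Fin d → ℤ) : Matrix (Fin d) (Fin d) ℤ :=
  (edgeMatrix v).det.sign • (edgeMatrix v).adjugate

theorem coordMatrix_mul_edgeMatrix {d : ℕ} (v : Fin (d + 1) → Fin d → ℤ) :
    coordMatrix v * edgeMatrix v = |(edgeMatrix v).det| • 1 := by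
  rw [coordMatrix, smul_mul_assoc, adjugate_mul, smul_smul, Int.sign_mul_self_eq_abs]

theorem natAbs_det_coordMatrix (v : Fin 5 → Fin 4 → ℤ) (h : (edgeMatrix v).det ≠ 0) :
    (coordMatrix v).det.natAbs = (edgeMatrix v).det.natAbs ^ 3 := by
  rw [coordMatrix, det_smul, det_adjugate, Int.natAbs_mul, Int.natAbs_pow, Int.natAbs_pow,
    Int.natAbs_sign_of_ne_zero h]
  simp

/-- Scaled barycentric coordinates express a lattice point through the edge vectors. -/
theorem sum_vecMul_coordMatrix {d : ℕ} (v : Fin (d + 1) → Fin d → ℤ) (z : Fin d → ℤ) :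
    ∑ i, (z ᵥ* coordMatrix v) i • (v i.castSucc - v (Fin.last d)) =
      |(edgeMatrix v).det| • z := by
  have h : (z ᵥ* coordMatrix v) ᵥ* edgeMatrix v = |(edgeMatrix v).det| • z := by
    rw [vecMul_vecMul, coordMatrix_mul_edgeMatrix, vecMul_smul, vecMul_one]
  rw [← h, Matrix.vecMul_eq_sum (z ᵥ* coordMatrix v)]
  rfl

theorem sum_vecMul_coordMatrix_div {d : ℕ} (v : Fin (d + 1) → Fin d → ℤ)
    (h : (edgeMatrix v).det ≠ 0) (z : Fin d → ℤ) :
    ∑ i : Fin d, (((z ᵥ* coordMatrix v) i : ℝ) / (|(edgeMatrix v).det| : ℤ)) •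
      (toR (v i.castSucc) - toR (v (Fin.last d))) = toR z := by
  have hM : ((|(edgeMatrix v).det| : ℤ) : ℝ) ≠ 0 := by exact_mod_cast abs_ne_zero.2 h
  ext j
  have := congrFun (sum_vecMul_coordMatrix v z) j
  simp only [Finset.sum_apply, Pi.smul_apply, smul_eq_mul, Pi.sub_apply] at this
  have h2 : ∑ i : Fin d, ((z ᵥ* coordMatrix v) i : ℝ) * (v i.castSucc j - v (Fin.last d) j) =
    (|(edgeMatrix v).det| : ℤ) * (z j : ℝ) := by exact_mod_cast this
  simp only [Finset.sum_apply, Pi.smul_apply, smul_eq_mul, Pi.sub_apply, toR, div_mul_eq_mul_div,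
    ← Finset.sum_div, h2]
  field_simp

theorem exists_int_weights {d : ℕ} {v : Fin (d + 1) → Fin d → ℤ} {β : Fin (d + 1) → ℝ}
    (hv : AffineIndependent ℝ fun i => toR (v i)) (hβ : ∑ i, β i = 1)
    (hβv : ∑ i, β i • toR (v i) = 0) :
    ∃ b : Fin (d + 1) → ℤ, ∀ i, (b i : ℝ) = (|(edgeMatrix v).det| : ℤ) * β i := by
  have hD := edgeMatrix_det_ne_zero hv
  have hM : ((|(edgeMatrix v).det| : ℤ) : ℝ) ≠ 0 := by exact_mod_cast abs_ne_zero.2 hD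
  set c := -v (Fin.last d) ᵥ* coordMatrix v with hc
  have h1 := sum_vecMul_coordMatrix_div v hD (-v (Fin.last d))
  rw [← hc] at h1
  have key : β = Fin.snoc (fun i => (c i : ℝ) / (|(edgeMatrix v).det| : ℤ))
      (1 - ∑ i, (c i : ℝ) / (|(edgeMatrix v).det| : ℤ)) := by
    apply hv.weights_eq
    · rw [hβ]
      simp [Fin.sum_univ_castSucc (n := d)]
    · rw [hβv]
      simp only [Fin.sum_univ_castSucc (n := d), Fin.snoc_castSucc, Fin.snoc_last]
      simp only [smul_sub, Finset.sum_sub_distrib, ← Finset.sum_smul] at h1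
      rw [sub_smul, add_sub_left_comm, h1]
      ext j
      simp [toR]
  refine ⟨Fin.snoc c (|(edgeMatrix v).det| - ∑ i, c i), fun i => ?_⟩
  rw [key]
  refine Fin.lastCases ?_ (fun i => ?_) i
  · simp only [Fin.snoc_last, mul_sub, Finset.mul_sum, mul_div_cancel₀ _ hM]
    push_cast
    simp
  · simp only [Fin.snoc_castSucc]
    field_simp

theorem IsCanonicalSimplex.smul_weights_sub {d : ℕ} {v : Fin (d + 1) → Fin d → ℤ}
    (hv : IsCanonicalSimplex v) {β : Fin (d + 1) → ℝ} (hβ : ∑ i, β i = 1)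
    (hβv : ∑ i, β i • toR (v i) = 0) (k : ℤ) (a : Fin (d + 1) → ℤ) (hk : k - ∑ i, a i = 1)
    (hpos : ∀ i, 0 < k * β i - a i) (i : Fin (d + 1)) : k * β i - a i = β i := by
  refine congrFun (hv.weights_eq hβ hβv hpos ?_ (-∑ i, a i • v i) ?_) i
  · rw [Finset.sum_sub_distrib, ← Finset.mul_sum, hβ, mul_one]
    exact_mod_cast hk
  · simp only [sub_smul, Finset.sum_sub_distrib, mul_smul, ← Finset.smul_sum, hβv]
    ext j
    simp [toR, Finset.sum_apply]

theorem IsCanonicalSimplex.vecMul_coordMatrix_eq_zero {d : ℕ} {v : Fin (d + 1) → Fin d → ℤ}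
    (hv : IsCanonicalSimplex v) {β : Fin (d + 1) → ℝ} (hβ : ∑ i, β i = 1)
    (hβv : ∑ i, β i • toR (v i) = 0) {b : Fin (d + 1) → ℤ}
    (hb : ∀ i, (b i : ℝ) = (|(edgeMatrix v).det| : ℤ) * β i) (z : Fin d → ℤ)
    (hz : ∀ i, 0 < (z ᵥ* coordMatrix v) i + b i.castSucc)
    (hz' : ∑ i, (z ᵥ* coordMatrix v) i < b (Fin.last d)) : z ᵥ* coordMatrix v = 0 := by
  have hD := edgeMatrix_det_ne_zero hv.1
  have hM : (0 : ℝ) < ((|(edgeMatrix v).det| : ℤ) : ℝ) := by exact_mod_cast abs_pos.2 hD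
  set c := z ᵥ* coordMatrix v with hc
  have h1 := sum_vecMul_coordMatrix_div v hD z
  rw [← hc] at h1
  set M : ℝ := ((|(edgeMatrix v).det| : ℤ) : ℝ) with hMdef
  have key : (Fin.snoc (fun i => β i.castSucc + c i / M)
      (β (Fin.last d) - ∑ i, c i / M) : Fin (d + 1) → ℝ) = β := by
    refine hv.weights_eq hβ hβv ?_ ?_ z ?_
    · intro i
      refine Fin.lastCases ?_ (fun i => ?_) i
      · simp only [Fin.snoc_last, ← Finset.sum_div]
        have h2 : (∑ i, (c i : ℝ)) < M * β (Fin.last d) := by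
          rw [← hb]; exact_mod_cast hz'
        rw [sub_pos, div_lt_iff₀ hM]
        linarith
      · simp only [Fin.snoc_castSucc]
        have h2 : (0 : ℝ) < c i + M * β i.castSucc := by
          rw [← hb]; exact_mod_cast hz i
        have : β i.castSucc + c i / M = (c i + M * β i.castSucc) / M := by field_simp; ring
        rw [this]
        positivity
    · rw [← hβ]
      simp [Fin.sum_univ_castSucc (n := d), Finset.sum_add_distrib]
    · rw [← h1]
      have h3 : ∑ i : Fin d, (β i.castSucc) • toR (v i.castSucc)
          = - (β (Fin.last d) • toR (v (Fin.last d))) := by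
        rw [eq_neg_iff_add_eq_zero, ← hβv, Fin.sum_univ_castSucc (n := d)]
      simp only [Fin.sum_univ_castSucc (n := d), Fin.snoc_castSucc, Fin.snoc_last, add_smul,
        Finset.sum_add_distrib, h3, smul_sub, Finset.sum_sub_distrib, ← Finset.sum_smul, sub_smul]
      abel
  funext i
  have := congrFun key i.castSucc
  simp only [Fin.snoc_castSucc, add_eq_left, div_eq_zero_iff, hM.ne', or_false] at this
  exact_mod_cast this

theorem mult_le_last_weight {d : ℕ} {v : Fin (d + 1) → Fin d → ℤ}
    (hv : AffineIndependent ℝ fun i => toR (v i)) {β : Fin (d + 1) → ℝ}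
    (hpos : 0 < β (Fin.last d)) (hβ : ∑ i, β i = 1) (hβv : ∑ i, β i • toR (v i) = 0)
    {b : Fin (d + 1) → ℤ} (hb : ∀ i, (b i : ℝ) = (|(edgeMatrix v).det| : ℤ) * β i) :
    (mult v : ℤ) ≤ b (Fin.last d) := by
  have hD := edgeMatrix_det_ne_zero hv
  let V : Matrix (Fin d) (Fin d) ℤ := fun i => v i.castSucc
  have hV : V.map (Int.castRingHom ℝ) =
      (1 - replicateCol (Fin 1) (fun _ : Fin d => (1 : ℝ)) *
        replicateRow (Fin 1) (fun i : Fin d => β i.castSucc)) *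
        (edgeMatrix v).map (Int.castRingHom ℝ) := by
    ext i j
    have h0 := congrFun hβv j
    simp only [Fin.sum_univ_castSucc (n := d)] at hβ h0
    simp only [Pi.add_apply, Finset.sum_apply, Pi.smul_apply, smul_eq_mul, toR,
      Pi.zero_apply] at h0
    have hl : V.map (Int.castRingHom ℝ) i j = (v i.castSucc j : ℝ) := rfl
    rw [hl, sub_mul, one_mul, Matrix.sub_apply, Matrix.mul_assoc, Matrix.mul_apply]
    simp only [Matrix.map_apply, edgeMatrix, Matrix.mul_apply, Finset.univ_unique,
      Finset.sum_singleton, replicateCol_apply, replicateRow_apply, one_mul, Pi.sub_apply,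
      map_sub, mul_sub, Finset.sum_sub_distrib, ← Finset.sum_mul, eq_intCast]
    linear_combination h0 - (v (Fin.last d) j : ℝ) * hβ
  have hdet : (V.det : ℝ) = β (Fin.last d) * (edgeMatrix v).det := by
    have h1 : (V.map (Int.castRingHom ℝ)).det = (V.det : ℝ) := (RingHom.map_det _ V).symm
    have h2 : ((edgeMatrix v).map (Int.castRingHom ℝ)).det = ((edgeMatrix v).det : ℝ) :=
      (RingHom.map_det _ _).symm
    rw [← h1, hV, det_mul, h2, det_one_sub_mul_comm]
    congr 1
    rw [Fin.sum_univ_castSucc (n := d)] at hβ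
    simp [Matrix.mul_apply]
    linarith
  have hVabs : |V.det| = b (Fin.last d) := by
    have : ((|V.det| : ℤ) : ℝ) = b (Fin.last d) := by
      rw [hb, Int.cast_abs, hdet, abs_mul, abs_of_pos hpos, Int.cast_abs, mul_comm]
    exact_mod_cast this
  have hV0 : V.det ≠ 0 := by
    intro h
    rw [h, Int.cast_zero, eq_comm, mul_eq_zero] at hdet
    rcases hdet with h | h
    · exact hpos.ne' h
    · exact hD (by exact_mod_cast h)
  have hidx := index_closure_range_rows V hV0
  have hle : AddSubgroup.closure (Set.range V.row) ≤ AddSubgroup.closure (Set.range v) := by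
    apply AddSubgroup.closure_mono
    rintro _ ⟨i, rfl⟩
    exact ⟨i.castSucc, rfl⟩
  have hdvd := AddSubgroup.index_dvd_of_le hle
  rw [hidx] at hdvd
  have := Nat.le_of_dvd (Int.natAbs_pos.2 hV0) hdvd
  rw [← hVabs, Int.abs_eq_natAbs]
  exact_mod_cast this

/-- Boxes with the side lengths of the scaled weights are packed by the coordinate lattice. -/
theorem IsCanonicalSimplex.box_card {v : Fin 5 → Fin 4 → ℤ}
    (hv : IsCanonicalSimplex v) {β : Fin 5 → ℝ} (hpos : ∀ i, 0 < β i) (hβ : ∑ i, β i = 1)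
    (hβv : ∑ i, β i • toR (v i) = 0) {b : Fin 5 → ℤ}
    (hb : ∀ i, (b i : ℝ) = (|(edgeMatrix v).det| : ℤ) * β i) (l : Fin 4 → ℤ) :
    b 0 * b 1 * b 2 * b 3 ≤ |(edgeMatrix v).det| ^ 3 ∧
    (b 0 * b 1 * b 2 * b 3 = |(edgeMatrix v).det| ^ 3 →
      ∃ z, ∀ i, (z ᵥ* coordMatrix v) i ∈ Finset.Ioc (l i) (l i + b i.castSucc)) := by
  have hD := edgeMatrix_det_ne_zero hv.1
  have hM : (0 : ℝ) < ((|(edgeMatrix v).det| : ℤ) : ℝ) := by exact_mod_cast abs_pos.2 hD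
  have hbpos : ∀ i, 0 < b i := fun i => by
    have : (0 : ℝ) < b i := by rw [hb]; exact mul_pos hM (hpos i)
    exact_mod_cast this
  have hdet := natAbs_det_coordMatrix v hD
  have hK : (coordMatrix v).det ≠ 0 := by
    rw [← Int.natAbs_ne_zero, hdet]
    exact pow_ne_zero _ (Int.natAbs_ne_zero.2 hD)
  set S : Finset (Fin 4 → ℤ) :=
    Fintype.piFinset fun i => Finset.Ioc (l i) (l i + b i.castSucc) with hS
  have hcard : (S.card : ℤ) = b 0 * b 1 * b 2 * b 3 := by
    rw [hS, Fintype.card_piFinset]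
    push_cast
    simp [Fin.prod_univ_four, (hbpos _).le]
  have hpack := card_le_natAbs_det_of_incongruent (coordMatrix v) hK S (by
    rintro x hx y hy ⟨z, hz⟩
    rw [hS, Fintype.mem_piFinset] at hx hy
    simp only [Finset.mem_Ioc] at hx hy
    have hzi : ∀ i, (z ᵥ* coordMatrix v) i = x i - y i := fun i => congrFun hz i
    suffices h : z ᵥ* coordMatrix v = 0 by
      rw [h, eq_comm, sub_eq_zero] at hz
      exact hz
    rcases le_total (∑ i, (z ᵥ* coordMatrix v) i) 0 with h | h
    · refine hv.vecMul_coordMatrix_eq_zero hβ hβv hb z (fun i => ?_) (h.trans_lt (hbpos _))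
      rw [hzi]
      have := hx i
      have := hy i
      lia
    · rw [← neg_eq_zero, ← neg_vecMul]
      refine hv.vecMul_coordMatrix_eq_zero hβ hβv hb (-z) (fun i => ?_) ?_
      · rw [neg_vecMul, Pi.neg_apply, hzi]
        have := hx i
        have := hy i
        lia
      · simp only [neg_vecMul, Pi.neg_apply, Finset.sum_neg_distrib]
        have := hbpos (Fin.last 4)
        linarith)
  rw [hdet] at hpack
  have habs : |(edgeMatrix v).det| ^ 3 = (((edgeMatrix v).det.natAbs ^ 3 : ℕ) : ℤ) := by
    rw [Int.abs_eq_natAbs]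
    push_cast
    rfl
  rw [habs, ← hcard]
  refine ⟨by exact_mod_cast hpack.1, fun h => ?_⟩
  obtain ⟨s, hs, z, rfl⟩ := hpack.2 (by exact_mod_cast h)
  exact ⟨z, fun i => Fintype.mem_piFinset.1 hs i⟩

theorem IsCanonicalSimplex.weight_bounds {v : Fin 5 → Fin 4 → ℤ} (hv : IsCanonicalSimplex v)
    {β : Fin 5 → ℝ} (hpos : ∀ i, 0 < β i) (hβ : ∑ i, β i = 1)
    (hβv : ∑ i, β i • toR (v i) = 0) (hanti : Antitone β) : β 0 ≤ 1 / 2 ∧ β 1 ≤ 1 / 3 := by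
  constructor
  · by_contra! h
    have h1 := hv.smul_weights_sub hβ hβv 2 ![1, 0, 0, 0, 0] (by simp [Fin.sum_univ_five])
      (fun i => by
        have := hpos i
        fin_cases i <;> simp at this ⊢ <;> linarith) 1
    have := hpos 1
    simp at h1
    linarith
  · by_contra! h
    have h01 : β 1 ≤ β 0 := hanti (by decide)
    have h1 := hv.smul_weights_sub hβ hβv 3 ![1, 1, 0, 0, 0] (by simp [Fin.sum_univ_five])
      (fun i => by
        have := hpos i
        fin_cases i <;> simp at this ⊢ <;> linarith) 2
    have := hpos 2
    simp at h1
    linarith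

theorem edge_eq_of_vecMul_coordMatrix {v : Fin 5 → Fin 4 → ℤ}
    (hM : |(edgeMatrix v).det| = 1024) {z : Fin 4 → ℤ} {j : Fin 4}
    (hz : z ᵥ* coordMatrix v = Pi.single j 128) :
    v j.castSucc - v (Fin.last 4) = 8 • z := by
  have h := sum_vecMul_coordMatrix v z
  rw [hz, hM] at h
  have h2 : (128 : ℤ) • (v j.castSucc - v (Fin.last 4)) = (1024 : ℤ) • z := by
    rw [← h, Finset.sum_eq_single j]
    · simp
    · intro i _ hij
      simp [hij]
    · simp
  ext i
  have := congrFun h2 i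
  simp only [Pi.smul_apply, smul_eq_mul, nsmul_eq_mul] at this ⊢
  lia

theorem IsCanonicalSimplex.exists_edge_eq {v : Fin 5 → Fin 4 → ℤ} (hv : IsCanonicalSimplex v)
    {β : Fin 5 → ℝ} (hpos : ∀ i, 0 < β i) (hβ : ∑ i, β i = 1)
    (hβv : ∑ i, β i • toR (v i) = 0) {b : Fin 5 → ℤ}
    (hb : ∀ i, (b i : ℝ) = (|(edgeMatrix v).det| : ℤ) * β i)
    (hM : |(edgeMatrix v).det| = 1024) (hb0 : b 0 = 512) (hb1 : b 1 = 128) (hb2 : b 2 = 128)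
    (hb3 : b 3 = 128) (hb4 : b 4 = 128) (j : Fin 4) (hj : j ≠ 0) :
    ∃ z : Fin 4 → ℤ, v j.castSucc - v (Fin.last 4) = 8 • z := by
  have hbj : b j.castSucc = 128 := by
    fin_cases j
    · exact absurd rfl hj
    · exact hb1
    · exact hb2
    · exact hb3
  obtain ⟨z, hz⟩ := (hv.box_card hpos hβ hβv hb
    (fun i => if i = j then 0 else -b i.castSucc)).2 (by rw [hb0, hb1, hb2, hb3, hM]; norm_num)
  refine ⟨z, edge_eq_of_vecMul_coordMatrix hM ?_⟩
  set c := z ᵥ* coordMatrix v with hc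
  simp only [Finset.mem_Ioc] at hz
  have hcj : 0 < c j ∧ c j ≤ 128 := by
    have := hz j
    rw [if_pos rfl, hbj] at this
    lia
  have hci : ∀ i, i ≠ j → -b i.castSucc < c i ∧ c i ≤ 0 := by
    intro i hij
    have := hz i
    rw [if_neg hij] at this
    lia
  have hsum : ∑ i, c i = c j + ∑ i ∈ Finset.univ.erase j, c i :=
    (Finset.add_sum_erase _ _ (Finset.mem_univ j)).symm
  have hrest : ∀ i ∈ Finset.univ.erase j, c i ≤ 0 := fun i hi => (hci i (Finset.ne_of_mem_erase hi)).2
  have hrest' := Finset.sum_nonpos hrest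
  have hge : 128 ≤ ∑ i, c i := by
    by_contra! hlt
    have h0 := hv.vecMul_coordMatrix_eq_zero hβ hβv hb z (fun i => by
      rw [← hc]
      by_cases hij : i = j
      · subst hij
        lia
      · have := hci i hij
        lia) (hlt.trans_eq hb4.symm)
    have := congrFun h0 j
    rw [← hc, Pi.zero_apply] at this
    lia
  have h0 : ∑ i ∈ Finset.univ.erase j, c i = 0 := by lia
  funext i
  by_cases hij : i = j
  · subst hij
    rw [Pi.single_eq_same]
    lia
  · rw [Pi.single_eq_of_ne hij]
    exact (Finset.sum_eq_zero_iff_of_nonpos hrest).1 h0 i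
      (Finset.mem_erase.2 ⟨hij, Finset.mem_univ i⟩)

theorem IsCanonicalSimplex.mult_le_of_antitone {v : Fin 5 → Fin 4 → ℤ}
    (hv : IsCanonicalSimplex v) {β : Fin 5 → ℝ} (hpos : ∀ i, 0 < β i) (hβ : ∑ i, β i = 1)
    (hβv : ∑ i, β i • toR (v i) = 0) (hanti : Antitone β) :
    mult v ≤ 128 ∧ (mult v = 128 →
      ∃ B : Matrix (Fin 4) (Fin 4) ℤ, IsUnit B.det ∧ ∀ i, dim4V (i + 1) = B *ᵥ v i) := by
  obtain ⟨b, hb⟩ := exists_int_weights hv.1 hβ hβv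
  have hD := edgeMatrix_det_ne_zero hv.1
  have hM : (0 : ℝ) < ((|(edgeMatrix v).det| : ℤ) : ℝ) := by exact_mod_cast abs_pos.2 hD
  have hmult := mult_le_last_weight hv.1 (hpos _) hβ hβv hb
  have hbox := (hv.box_card hpos hβ hβv hb 0).1
  have hsum := hβ
  rw [Fin.sum_univ_five] at hsum
  obtain ⟨hw0, hw1⟩ := hv.weight_bounds hpos hβ hβv hanti
  have hopt := one_le_of_weight_bounds hsum hw0 hw1 (hanti (by decide)) (hanti (by decide))
    (hanti (by decide)) (hanti (by decide)) (hpos 4)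
  set M : ℝ := ((|(edgeMatrix v).det| : ℤ) : ℝ) with hMdef
  have hboxR : (M * β 3) * (β 0 * β 1 * β 2) ≤ 1 := by
    have h : (b 0 * b 1 * b 2 * b 3 : ℝ) ≤ M ^ 3 := by
      rw [hMdef]
      exact_mod_cast hbox
    simp only [hb] at h
    have h3 : M ^ 3 * ((M * β 3) * (β 0 * β 1 * β 2)) ≤ M ^ 3 * 1 := by linarith
    exact le_of_mul_le_mul_left h3 (by positivity)
  have hM3 : 0 < M * β 3 := mul_pos hM (hpos 3)
  have h34 : M * β 4 ≤ M * β 3 := mul_le_mul_of_nonneg_left (hanti (by decide)) hM.le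
  have hb3 : M * β 3 ≤ 128 := by
    have := mul_le_mul_of_nonneg_left hopt.1 hM3.le
    linarith
  have hmultR : (mult v : ℝ) ≤ M * β 4 := by
    have : (mult v : ℝ) ≤ b 4 := by exact_mod_cast hmult
    rwa [hb] at this
  refine ⟨by exact_mod_cast hmultR.trans (h34.trans hb3), fun heq => ?_⟩
  rw [heq] at hmultR
  push_cast at hmultR
  have h3 : M * β 3 = 128 := by linarith
  obtain ⟨e0, e1, e2, e3, e4⟩ := hopt.2 (le_antisymm (by rw [h3] at hboxR; linarith) hopt.1)
  have hM' : M = 1024 := by rw [e3] at h3; linarith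
  have hMZ : |(edgeMatrix v).det| = 1024 := by
    have h := hM'
    rw [hMdef] at h
    exact_mod_cast h
  have hbZ : ∀ i (n : ℤ), M * β i = n → b i = n := fun i n h => by
    have := (hb i).trans h
    exact_mod_cast this
  have hb0 : b 0 = 512 := hbZ _ _ (by rw [hM', e0]; norm_num)
  have hb1 : b 1 = 128 := hbZ _ _ (by rw [hM', e1]; norm_num)
  have hb2 : b 2 = 128 := hbZ _ _ (by rw [hM', e2]; norm_num)
  have hb3 : b 3 = 128 := hbZ _ _ (by rw [hM', e3]; norm_num)
  have hb4 : b 4 = 128 := hbZ _ _ (by rw [hM', e4]; norm_num)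
  have hrel : ∀ k, 4 * v 0 k + v 1 k + v 2 k + v 3 k + v 4 k = 0 := by
    intro k
    have h := congrFun hβv k
    rw [Fin.sum_univ_five, e0, e1, e2, e3, e4] at h
    simp only [Pi.add_apply, Pi.smul_apply, smul_eq_mul, toR, Pi.zero_apply] at h
    have h2 : (4 * v 0 k + v 1 k + v 2 k + v 3 k + v 4 k : ℝ) = 0 := by linarith
    exact_mod_cast h2
  have hedge := hv.exists_edge_eq hpos hβ hβv hb hMZ hb0 hb1 hb2 hb3 hb4
  obtain ⟨z1, hz1⟩ := hedge 1 (by decide)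
  obtain ⟨z2, hz2⟩ := hedge 2 (by decide)
  obtain ⟨z3, hz3⟩ := hedge 3 (by decide)
  have g1 : ∀ k, v 1 k - v 4 k = 8 * z1 k := fun k => by simpa using congrFun hz1 k
  have g2 : ∀ k, v 2 k - v 4 k = 8 * z2 k := fun k => by simpa using congrFun hz2 k
  have g3 : ∀ k, v 3 k - v 4 k = 8 * z3 k := fun k => by simpa using congrFun hz3 k
  let A : Matrix (Fin 4) (Fin 4) ℤ := ![v 0 + z1 + z2 + z3, z1, z2, z3]
  have hDA : edgeMatrix v = Matrix.diagonal ![2, 8, 8, 8] * A := by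
    ext i k
    rw [Matrix.diagonal_mul]
    have := hrel k
    have := g1 k
    have := g2 k
    have := g3 k
    fin_cases i
    · change v 0 k - v 4 k = 2 * (v 0 k + z1 k + z2 k + z3 k)
      lia
    · exact g1 k
    · exact g2 k
    · exact g3 k
  have hA : IsUnit A.det := by
    rw [hDA, det_mul, det_diagonal, Fin.prod_univ_four, abs_mul] at hMZ
    rw [Int.isUnit_iff_abs_eq]
    simp at hMZ
    lia
  have hA' : ∀ i, v i = Aᵀ *ᵥ dim4V (i + 1) := by
    intro i
    ext k
    have := hrel k
    have := g1 k
    have := g2 k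
    have := g3 k
    rw [mulVec_transpose, Matrix.vecMul_eq_sum, Fin.sum_univ_four]
    simp only [Pi.add_apply, Pi.smul_apply, smul_eq_mul]
    change _ = dim4V (i + 1) 0 * (v 0 k + z1 k + z2 k + z3 k) + dim4V (i + 1) 1 * z1 k +
      dim4V (i + 1) 2 * z2 k + dim4V (i + 1) 3 * z3 k
    fin_cases i <;> simp [dim4V] <;> lia
  have hAT : IsUnit Aᵀ.det := by rwa [det_transpose]
  refine ⟨Aᵀ⁻¹, Matrix.isUnit_nonsing_inv_det _ hAT, fun i => ?_⟩
  rw [hA' i, mulVec_mulVec, Matrix.nonsing_inv_mul _ hAT, one_mulVec]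

theorem AffineBasis.mem_extremePoints_convexHull {ι V : Type*} [Fintype ι] [AddCommGroup V]
    [Module ℝ V] (B : AffineBasis ι ℝ V) (i : ι) :
    B i ∈ (convexHull ℝ (Set.range B)).extremePoints ℝ := by
  classical
  rw [mem_extremePoints_iff_left]
  refine ⟨subset_convexHull ℝ _ ⟨i, rfl⟩, ?_⟩
  rw [B.convexHull_eq_nonneg_coord]
  rintro x hx y hy ⟨a, b, ha, hb, hab, h⟩
  have hcoord : ∀ j, j ≠ i → B.coord j x = 0 := by
    intro j hj
    have h1 : B.coord j (B i) = a * B.coord j x + b * B.coord j y := by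
      rw [← h, Convex.combo_affine_apply hab]
      rfl
    rw [B.coord_apply_ne hj] at h1
    have h2 := mul_nonneg ha.le (hx j)
    have h3 := mul_nonneg hb.le (hy j)
    have h4 : a * B.coord j x = 0 := by linarith
    exact (mul_eq_zero.1 h4).resolve_left ha.ne'
  refine (B.ext_elem fun j => ?_)
  by_cases hj : j = i
  · subst hj
    rw [B.coord_apply_eq]
    have := B.sum_coord_apply_eq_one x
    rwa [Finset.sum_eq_single j (fun k _ hk => hcoord k hk) (by simp)] at this
  · rw [hcoord j hj, B.coord_apply_ne hj]

theorem toR_injective {d : ℕ} : Function.Injective (toR (d := d)) := fun _ _ h =>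
  funext fun j => Int.cast_injective (α := ℝ) (congrFun h j)

theorem toR_add {d : ℕ} (x y : Fin d → ℤ) : toR (x + y) = toR x + toR y := by
  ext j
  simp [toR]

theorem toR_mulVec {d : ℕ} (A : Matrix (Fin d) (Fin d) ℤ) (x : Fin d → ℤ) :
    toR (A *ᵥ x) = A.map (fun n : ℤ => (n : ℝ)) *ᵥ toR x := by
  ext j
  simp [toR, mulVec, dotProduct]

theorem range_subset_of_hullOf_eq {d : ℕ} {u v : Fin (d + 1) → Fin d → ℤ}
    (hu : AffineIndependent ℝ fun i => toR (u i)) (h : hullOf u = hullOf v) :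
    Set.range u ⊆ Set.range v := by
  rintro _ ⟨i, rfl⟩
  obtain ⟨B, hB⟩ := exists_affineBasis hu
  have h1 := B.mem_extremePoints_convexHull i
  rw [hB] at h1
  change _ ∈ (hullOf u).extremePoints ℝ at h1
  rw [h] at h1
  obtain ⟨j, hj⟩ := extremePoints_convexHull_subset h1
  exact ⟨j, toR_injective hj⟩

theorem hullOf_mulVec_add {d : ℕ} (v : Fin (d + 1) → Fin d → ℤ) (A : Matrix (Fin d) (Fin d) ℤ)
    (w : Fin d → ℤ) :
    hullOf (fun i => A *ᵥ v i + w) =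
      (fun x => (A.map fun n : ℤ => (n : ℝ)) *ᵥ x + toR w) '' hullOf v := by
  let f : (Fin d → ℝ) →ᵃ[ℝ] (Fin d → ℝ) :=
    (A.map fun n : ℤ => (n : ℝ)).mulVecLin.toAffineMap + AffineMap.const ℝ _ (toR w)
  change _ = f '' convexHull ℝ _
  rw [f.image_convexHull, ← Set.range_comp, hullOf]
  congr 2
  funext i
  rw [toR_add, toR_mulVec]
  rfl

theorem affineIndependent_mulVec_add {d : ℕ} {v : Fin (d + 1) → Fin d → ℤ}
    (hv : AffineIndependent ℝ fun i => toR (v i)) {A : Matrix (Fin d) (Fin d) ℤ}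
    (hA : IsUnit A.det) (w : Fin d → ℤ) :
    AffineIndependent ℝ fun i => toR (A *ᵥ v i + w) := by
  let f : (Fin d → ℝ) →ᵃ[ℝ] (Fin d → ℝ) :=
    (A.map fun n : ℤ => (n : ℝ)).mulVecLin.toAffineMap + AffineMap.const ℝ _ (toR w)
  have hf : Function.Injective f := by
    intro x y hxy
    have h1 : (A.map fun n : ℤ => (n : ℝ)) *ᵥ x = (A.map fun n : ℤ => (n : ℝ)) *ᵥ y :=
      add_right_cancel hxy
    refine mulVec_injective_iff_isUnit.2 ?_ h1
    rw [isUnit_iff_isUnit_det]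
    have h2 : (A.map fun n : ℤ => (n : ℝ)).det = (A.det : ℝ) :=
      (RingHom.map_det (Int.castRingHom ℝ) A).symm
    rw [h2]
    exact hA.map (Int.castRingHom ℝ)
  have h := hv.map' f hf
  convert h using 1
  funext i
  rw [toR_add, toR_mulVec]
  rfl

theorem mult_mulVec {d : ℕ} (v : Fin (d + 1) → Fin d → ℤ) {A : Matrix (Fin d) (Fin d) ℤ}
    (hA : IsUnit A.det) : mult (fun i => A *ᵥ v i) = mult v := by
  have hbij : Function.Bijective A.mulVecLin.toAddMonoidHom := by
    refine ⟨fun x y hxy => ?_, mulVec_surjective_iff_isUnit.2 (A.isUnit_iff_isUnit_det.2 hA)⟩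
    have h : A *ᵥ x = A *ᵥ y := hxy
    have := congrArg (A⁻¹ *ᵥ ·) h
    simpa [mulVec_mulVec, Matrix.nonsing_inv_mul _ hA] using this
  rw [mult, mult, ← AddSubgroup.index_map_of_bijective hbij (AddSubgroup.closure (Set.range v)),
    AddMonoidHom.map_closure, ← Set.range_comp]
  rfl

theorem affineIndependent_dim4V : AffineIndependent ℝ fun i => toR (dim4V i) := by
  rw [affineIndependent_iff_of_fintype]
  intro c hc h
  rw [Finset.univ.weightedVSub_eq_linear_combination hc] at h
  rw [Fin.sum_univ_five] at hc h
  have h0 := congrFun h 0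
  have h1 := congrFun h 1
  have h2 := congrFun h 2
  have h3 := congrFun h 3
  simp [toR, dim4V] at h0 h1 h2 h3
  intro i
  fin_cases i <;> simp <;> linarith

theorem eq_zero_of_mem_interior_dim4V (x : Fin 4 → ℤ)
    (hx : toR x ∈ interior (hullOf dim4V)) : x = 0 := by
  obtain ⟨w, hw, hw1, h⟩ := (mem_interior_hullOf_iff affineIndependent_dim4V _).1 hx
  rw [Fin.sum_univ_five] at hw1 h
  have h0 := congrFun h 0
  have h1 := congrFun h 1
  have h2 := congrFun h 2
  have h3 := congrFun h 3
  simp [toR, dim4V] at h0 h1 h2 h3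
  have p0 := hw 0
  have p1 := hw 1
  have p2 := hw 2
  have p3 := hw 3
  have p4 := hw 4
  have q0 : -1 < x 0 := by
    have : (-1 : ℝ) < x 0 := by linarith
    exact_mod_cast this
  have q1 : -1 < x 1 := by
    have : (-1 : ℝ) < x 1 := by linarith
    exact_mod_cast this
  have q2 : -1 < x 2 := by
    have : (-1 : ℝ) < x 2 := by linarith
    exact_mod_cast this
  have q3 : -1 < x 3 := by
    have : (-1 : ℝ) < x 3 := by linarith
    exact_mod_cast this
  have q4 : 4 * x 0 + x 1 + x 2 + x 3 < 1 := by
    have : (4 * x 0 + x 1 + x 2 + x 3 : ℝ) < 1 := by linarith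
    exact_mod_cast this
  ext j
  fin_cases j <;> simp <;> lia

theorem mult_dim4V : mult dim4V = 128 := by
  let V : Matrix (Fin 4) (Fin 4) ℤ := fun i => dim4V i.succ
  have hV : V = !![1, -1, -1, -1; -1, 7, -1, -1; -1, -1, 7, -1; -1, -1, -1, 7] := by
    ext i j
    fin_cases i <;> fin_cases j <;> rfl
  have hdet : V.det.natAbs = 128 := by
    rw [hV]
    decide +kernel
  have hcl : AddSubgroup.closure (Set.range dim4V) = AddSubgroup.closure (Set.range V.row) := by
    apply le_antisymm
    · rw [AddSubgroup.closure_le]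
      rintro _ ⟨i, rfl⟩
      refine Fin.cases ?_ (fun i => AddSubgroup.subset_closure ⟨i, rfl⟩) i
      rw [SetLike.mem_coe, mem_closure_range_rows]
      exact ⟨![-4, -1, -1, -1], by rw [hV]; decide⟩
    · apply AddSubgroup.closure_mono
      rintro _ ⟨i, rfl⟩
      exact ⟨i.succ, rfl⟩
  rw [mult, hcl, index_closure_range_rows, hdet]
  rw [← Int.natAbs_ne_zero, hdet]
  norm_num

theorem mult_eq_of_unimodEquiv {v : Fin 5 → Fin 4 → ℤ} (hv : IsCanonicalSimplex v)
    (h : UnimodEquiv (hullOf v) (hullOf dim4V)) : mult v = 128 := by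
  obtain ⟨A, w, hA, h⟩ := h
  rw [← hullOf_mulVec_add] at h
  have hind := affineIndependent_mulVec_add hv.1 hA w
  obtain ⟨β, hpos, hβ, hβv⟩ := hv.exists_weights
  have hw : w = 0 := by
    apply eq_zero_of_mem_interior_dim4V
    rw [h, mem_interior_hullOf_iff hind]
    refine ⟨β, hpos, hβ, ?_⟩
    simp only [toR_add, toR_mulVec, smul_add, Finset.sum_add_distrib, ← Finset.sum_smul, hβ,
      one_smul, ← mulVec_smul, ← mulVec_sum, hβv, mulVec_zero, zero_add]
  have hrange : Set.range (fun i => A *ᵥ v i + w) = Set.range dim4V :=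
    (range_subset_of_hullOf_eq hind h.symm).antisymm
      (range_subset_of_hullOf_eq affineIndependent_dim4V h)
  simp only [hw, add_zero] at hrange
  rw [← mult_mulVec v hA, ← mult_dim4V, mult, mult, hrange]

/-- A `4`-dimensional canonical lattice simplex has multiplicity at most `128`,
with equality iff it is unimodularly equivalent to
`conv{0, 2 e_1, 8 e_2, 8 e_3, 8 e_4} - (1,1,1,1)`. -/
theorem mult_le_of_canonical_dim4 (v : Fin 5 → Fin 4 → ℤ) (hv : IsCanonicalSimplex v) :
    mult v ≤ 128 ∧ (mult v = 128 ↔ UnimodEquiv (hullOf v) (hullOf dim4V)) := by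
  obtain ⟨β, hpos, hβ, hβv⟩ := hv.exists_weights
  let σ := Tuple.sort (fun i => -β i)
  have hσ : Antitone (β ∘ σ) := fun i j hij =>
    neg_le_neg_iff.1 (Tuple.monotone_sort (fun i => -β i) hij)
  have hhull : hullOf (v ∘ σ) = hullOf v := by
    change convexHull ℝ (Set.range ((fun i => toR (v i)) ∘ σ)) = _
    rw [EquivLike.range_comp]
    rfl
  have hmult : mult (v ∘ σ) = mult v := by rw [mult, EquivLike.range_comp, mult]
  have hv' : IsCanonicalSimplex (v ∘ σ) := by
    refine ⟨hv.1.comp_embedding σ.toEmbedding, ?_⟩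
    rw [hhull]
    exact hv.2
  have key := hv'.mult_le_of_antitone (fun i => hpos (σ i)) ((Equiv.sum_comp σ β).trans hβ)
    ((Equiv.sum_comp σ fun i => β i • toR (v i)).trans hβv) hσ
  rw [hmult] at key
  refine ⟨key.1, fun h => ?_, mult_eq_of_unimodEquiv hv⟩
  obtain ⟨B, hB, hBv⟩ := key.2 h
  refine ⟨B, 0, hB, ?_⟩
  rw [← hhull, ← hullOf_mulVec_add]
  simp only [add_zero, ← hBv]
  change _ = convexHull ℝ (Set.range ((fun i => toR (dim4V i)) ∘ Equiv.addRight 1))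
  rw [EquivLike.range_comp]
  rfl
end

section
/- Let P ⊂ ℝ^d be a d-dimensional canonical lattice simplex whose vertices v_0, …, v_d are primitive lattice vectors, and let (λ_0, …, λ_d) be its reduced weights, ordered so that λ_d ≤ λ_i for all 0 ≤ i < d. Set h := λ_0 + ⋯ + λ_d. Then mult(P) · λ_0 ⋯ λ_{d-1} ≤ h^{d-1}. -/
open MeasureTheory Module in
/-- The **linear forms theorem of Minkowski**, in the form: a parallelepiped
`{∑ tᵢ aᵢ : |tᵢ| < βᵢ}` with `|det a| * ∏ βᵢ > 1` contains a nonzero integer vector. -/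
theorem exists_ne_zero_eq_sum_smul {d : ℕ} (a : Fin d → Fin d → ℤ) (β : Fin d → ℝ)
    (hβ : ∀ i, 0 < β i) (hvol : 1 < ((Matrix.of a).det.natAbs : ℝ) * ∏ i, β i) :
    ∃ x : Fin d → ℤ, x ≠ 0 ∧ ∃ t : Fin d → ℝ, (∀ i, |t i| < β i) ∧
      toR x = ∑ i, t i • toR (a i) := by
  set A : Matrix (Fin d) (Fin d) ℝ := (Matrix.of a).map (Int.castRingHom ℝ) with hA
  set f : (Fin d → ℝ) →ₗ[ℝ] (Fin d → ℝ) := Matrix.toLin' A.transpose with hf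
  set B : Set (Fin d → ℝ) := Set.univ.pi fun i => Set.Ioo (-β i) (β i) with hB
  have hdet : |LinearMap.det f| = ((Matrix.of a).det.natAbs : ℝ) := by
    rw [hf, LinearMap.det_toLin', Matrix.det_transpose, hA, ← RingHom.mapMatrix_apply,
      ← RingHom.map_det]
    simp [Nat.cast_natAbs]
  have hBvol : volume B = ENNReal.ofReal (∏ i, (2 * β i)) := by
    rw [hB, volume_pi_pi, ENNReal.ofReal_prod_of_nonneg fun i _ => by linarith [hβ i]]
    exact Finset.prod_congr rfl fun i _ => by rw [Real.volume_Ioo]; ring_nf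
  have hlt : volume (ZSpan.fundamentalDomain (Pi.basisFun ℝ (Fin d))) *
      2 ^ finrank ℝ (Fin d → ℝ) < volume (f '' B) := by
    rw [Measure.addHaar_image_linearMap, hBvol, hdet, ZSpan.fundamentalDomain_pi_basisFun,
      volume_pi_pi, ← ENNReal.ofReal_mul (by positivity), Finset.prod_mul_distrib]
    simp only [Real.volume_Ico, sub_zero, ENNReal.ofReal_one, Finset.prod_const_one, one_mul,
      finrank_fin_fun, Finset.prod_const, Finset.card_univ, Fintype.card_fin]
    rw [← ENNReal.ofReal_ofNat, ← ENNReal.ofReal_pow (by norm_num)]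
    refine (ENNReal.ofReal_lt_ofReal_iff_of_nonneg (by positivity)).2 ?_
    have : (0 : ℝ) < 2 ^ d := by positivity
    nlinarith
  have hconv : Convex ℝ (f '' B) :=
    (convex_pi fun i _ => convex_Ioo (-β i) (β i)).linear_image f
  have hsymm : ∀ x ∈ f '' B, -x ∈ f '' B := by
    rintro _ ⟨t, ht, rfl⟩
    refine ⟨-t, fun i _ => ?_, map_neg f t⟩
    have := ht i trivial
    simp only [Set.mem_Ioo, Pi.neg_apply] at this ⊢
    constructor <;> linarith
  have : Countable (Submodule.span ℤ (Set.range (Pi.basisFun ℝ (Fin d)))).toAddSubgroup :=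
    inferInstanceAs (Countable (Submodule.span ℤ (Set.range (Pi.basisFun ℝ (Fin d)))))
  obtain ⟨⟨y, hyL⟩, hy0, t, ht, hty⟩ :=
    exists_ne_zero_mem_lattice_of_measure_mul_two_pow_lt_measure
      (ZSpan.isAddFundamentalDomain' (Pi.basisFun ℝ (Fin d)) volume) hsymm hconv hlt
  choose x hx using (Module.Basis.mem_span_iff_repr_mem ℤ (Pi.basisFun ℝ (Fin d)) y).1 hyL
  have hxy : toR x = y := funext fun i => by simpa [toR] using hx i
  refine ⟨x, ?_, t, fun i => abs_lt.2 (ht i trivial), ?_⟩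
  · rintro rfl
    exact hy0 (Subtype.ext (hxy.symm.trans (by ext; simp [toR])))
  · rw [hxy, ← show f t = y from hty]
    ext j
    simp [hf, hA, Matrix.mulVec, dotProduct, toR, mul_comm]

/-- The subgroup of `ℤ^d` generated by `d` linearly independent vectors has index `|det|`. -/
theorem index_closure_range_eq_natAbs_det {d : ℕ} (a : Fin d → Fin d → ℤ)
    (ha : LinearIndependent ℤ a) :
    (AddSubgroup.closure (Set.range a)).index = (Matrix.of a).det.natAbs := by
  rw [← Submodule.span_int_eq_addSubgroupClosure,
    AddSubgroup.index_eq_natAbs_det (Pi.basisFun ℤ (Fin d)) _ (Module.Basis.span ha),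
    Pi.basisFun_det_apply]
  congr 2
  ext i j
  exact congrFun (congrArg Subtype.val (Module.Basis.span_apply ha i)) j

theorem sum_zsmul_eq_zero_of_affineIndependent {d : ℕ} {v : Fin (d + 1) → Fin d → ℤ}
    (hv : AffineIndependent ℝ fun i => toR (v i)) {c : Fin (d + 1) → ℤ}
    (hsum : ∑ i, c i = 0) (hc : ∑ i, c i • v i = 0) (i : Fin (d + 1)) : c i = 0 := by
  have h := affineIndependent_iff.1 hv Finset.univ (fun i => (c i : ℝ)) (mod_cast hsum) (by
    ext j
    have := congrFun hc j
    simp only [Finset.sum_apply, Pi.smul_apply, smul_eq_mul, Pi.zero_apply, toR] at this ⊢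
    exact_mod_cast this) i (Finset.mem_univ i)
  exact_mod_cast h

/-- The coefficient sum of an integral relation between the vertices of a simplex is a multiple
of the sum of the reduced weights. -/
theorem sum_weights_dvd_sum {d : ℕ} {v : Fin (d + 1) → Fin d → ℤ}
    (hv : AffineIndependent ℝ fun i => toR (v i))
    {lam : Fin (d + 1) → ℕ} (hcop : Finset.univ.gcd lam = 1)
    (hrel : ∑ i, (lam i : ℤ) • v i = 0) {c : Fin (d + 1) → ℤ} (hc : ∑ i, c i • v i = 0) :
    ((∑ i, lam i : ℕ) : ℤ) ∣ ∑ i, c i := by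
  have key : ∀ i, (∑ j, (lam j : ℤ)) * c i - (∑ j, c j) * lam i = 0 :=
    sum_zsmul_eq_zero_of_affineIndependent hv
      (by rw [Finset.sum_sub_distrib, ← Finset.mul_sum, ← Finset.mul_sum]; ring)
      (by simp only [sub_smul, mul_smul, Finset.sum_sub_distrib, ← Finset.smul_sum, hc, hrel,
        smul_zero, sub_zero])
  have hdvd : (∑ i, lam i) ∣ Finset.univ.gcd fun i => (∑ j, c j).natAbs * lam i := by
    refine Finset.dvd_gcd fun i _ => ?_
    have h : ((∑ i, lam i : ℕ) : ℤ) ∣ (∑ j, c j) * lam i :=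
      ⟨c i, by push_cast; linarith [key i]⟩
    simpa [Int.natAbs_mul] using Int.natCast_dvd.1 h
  rw [Finset.gcd_mul_left, hcop] at hdvd
  exact Int.natCast_dvd.2 (by simpa using hdvd)

/-- Edge vectors of the simplex emanating from its last vertex. -/
def edges {d : ℕ} (v : Fin (d + 1) → Fin d → ℤ) (i : Fin d) : Fin d → ℤ :=
  v i.castSucc - v (Fin.last d)

theorem sum_smul_edges {d : ℕ} (v : Fin (d + 1) → Fin d → ℤ) (c : Fin d → ℤ) :
    ∑ i, c i • edges v i =
      ∑ i, (Fin.snoc c (-∑ i, c i) : Fin (d + 1) → ℤ) i • v i := by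
  simp only [edges, smul_sub, Finset.sum_sub_distrib, Finset.sum_smul, Fin.sum_univ_castSucc,
    Fin.snoc_castSucc, Fin.snoc_last, neg_smul, ← sub_eq_add_neg]

theorem linearIndependent_edges {d : ℕ} {v : Fin (d + 1) → Fin d → ℤ}
    (hv : AffineIndependent ℝ fun i => toR (v i)) : LinearIndependent ℤ (edges v) := by
  refine Fintype.linearIndependent_iff.2 fun c hc i => ?_
  rw [sum_smul_edges] at hc
  simpa using sum_zsmul_eq_zero_of_affineIndependent hv
    (by simp [Fin.sum_univ_castSucc]) hc i.castSucc

/-- The normalized volume of the simplex is at least `h * mult v`. -/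
theorem sum_weights_mul_mult_le {d : ℕ} {v : Fin (d + 1) → Fin d → ℤ}
    (hv : AffineIndependent ℝ fun i => toR (v i))
    {lam : Fin (d + 1) → ℕ} (hcop : Finset.univ.gcd lam = 1)
    (hrel : ∑ i, (lam i : ℤ) • v i = 0) :
    (∑ i, lam i) * mult v ≤ (Matrix.of (edges v)).det.natAbs := by
  have hli := linearIndependent_edges hv
  rw [← index_closure_range_eq_natAbs_det _ hli]
  set M := AddSubgroup.closure (Set.range (edges v)) with hM
  have hM0 : M.index ≠ 0 := by
    rw [hM, index_closure_range_eq_natAbs_det _ hli, Int.natAbs_ne_zero]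
    intro h0
    obtain ⟨c, hc0, hc⟩ := Matrix.exists_vecMul_eq_zero_iff.2 h0
    refine hc0 (funext fun i => Fintype.linearIndependent_iff.1 hli c ?_ i)
    rw [← hc]
    ext j
    simp [Matrix.vecMul, dotProduct]
  have : Finite ((Fin d → ℤ) ⧸ M) := Nat.finite_of_card_ne_zero hM0
  set q : (Fin d → ℤ) ⧸ M := QuotientAddGroup.mk (v (Fin.last d)) with hq
  set Z := AddSubgroup.zmultiples q with hZ
  have hcard : addOrderOf q * Z.index = M.index := by
    rw [← Nat.card_zmultiples, AddSubgroup.card_mul_index]; rfl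
  have hmult : mult v ≤ Z.index := by
    rw [← Z.index_comap_of_surjective (QuotientAddGroup.mk'_surjective M)]
    refine Nat.le_of_dvd (Nat.pos_of_ne_zero ?_) (AddSubgroup.index_dvd_of_le ?_)
    · rw [Z.index_comap_of_surjective (QuotientAddGroup.mk'_surjective M)]
      exact AddSubgroup.index_ne_zero_of_finite
    · have hvmem : ∀ i, v i ∈ AddSubgroup.closure (Set.range v) := fun i =>
        AddSubgroup.subset_closure ⟨i, rfl⟩
      have hMle : M ≤ AddSubgroup.closure (Set.range v) := by
        rw [hM, AddSubgroup.closure_le]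
        rintro _ ⟨i, rfl⟩
        exact sub_mem (hvmem _) (hvmem _)
      intro x hx
      obtain ⟨k, hk⟩ := AddSubgroup.mem_zmultiples_iff.1 (AddSubgroup.mem_comap.1 hx)
      have hmem : -(k • v (Fin.last d)) + x ∈ M := QuotientAddGroup.eq.1 (by simpa [hq] using hk)
      simpa using add_mem (zsmul_mem (hvmem (Fin.last d)) k) (hMle hmem)
  have horder : ∑ i, lam i ≤ addOrderOf q := by
    refine Nat.le_of_dvd (addOrderOf_pos q) ?_
    have hmem : addOrderOf q • v (Fin.last d) ∈ M := by
      rw [← QuotientAddGroup.eq_zero_iff, QuotientAddGroup.mk_nsmul]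
      exact addOrderOf_nsmul_eq_zero q
    have hmem' : addOrderOf q • v (Fin.last d) ∈ Submodule.span ℤ (Set.range (edges v)) := by
      rwa [← Submodule.mem_toAddSubgroup, Submodule.span_int_eq_addSubgroupClosure]
    obtain ⟨c, hc⟩ := (Submodule.mem_span_range_iff_exists_fun ℤ).1 hmem'
    have := sum_weights_dvd_sum hv hcop hrel
      (c := Fin.snoc c (-∑ i, c i) - Pi.single (Fin.last d) (addOrderOf q : ℤ)) (by
        simp only [Pi.sub_apply, sub_smul, Finset.sum_sub_distrib]
        rw [← sum_smul_edges, hc]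
        simp [Pi.single_apply, ite_smul])
    rw [← Int.natCast_dvd_natCast]
    simpa [Finset.sum_sub_distrib, Fin.sum_univ_castSucc] using this
  rw [← hcard]
  exact Nat.mul_le_mul horder hmult

theorem sum_smul_mem_interior_hullOf {d : ℕ} {v : Fin (d + 1) → Fin d → ℤ}
    (hv : AffineIndependent ℝ fun i => toR (v i)) {w : Fin (d + 1) → ℝ}
    (hpos : ∀ i, 0 < w i) (hw : ∑ i, w i = 1) :
    ∑ i, w i • toR (v i) ∈ interior (hullOf v) := by
  let b : AffineBasis (Fin (d + 1)) ℝ (Fin d → ℝ) :=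
    ⟨fun i => toR (v i), hv, hv.affineSpan_eq_top_iff_card_eq_finrank_add_one.2 (by simp)⟩
  have hint : interior (hullOf v) = {x | ∀ i, 0 < b.coord i x} := b.interior_convexHull
  rw [hint]
  intro i
  have h := b.coord_apply_combination_of_mem (Finset.mem_univ i) hw
  rw [Finset.affineCombination_eq_linear_combination _ _ _ hw] at h
  exact (hpos i).trans_eq h.symm

/-- If the origin has barycentric coordinates `β`, then a lattice point with coordinates
`|tᵢ| < βᵢ` along the edges at the last vertex and `∑ tᵢ ≤ 0` is interior to the simplex. -/
theorem mem_interior_hullOf_of_sum_nonpos {d : ℕ} {v : Fin (d + 1) → Fin d → ℤ}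
    (hv : AffineIndependent ℝ fun i => toR (v i)) {β : Fin (d + 1) → ℝ} (hβ : ∀ i, 0 < β i)
    (hβ1 : ∑ i, β i = 1) (hβ0 : ∑ i, β i • toR (v i) = 0) {x : Fin d → ℤ} {t : Fin d → ℝ}
    (ht : ∀ i, |t i| < β i.castSucc) (hx : toR x = ∑ i, t i • toR (edges v i))
    (hsum : ∑ i, t i ≤ 0) : toR x ∈ interior (hullOf v) := by
  have hxe : toR x = ∑ i, (β + Fin.snoc t (-∑ i, t i) : Fin (d + 1) → ℝ) i • toR (v i) := by
    have hedge : ∀ i, toR (edges v i) = toR (v i.castSucc) - toR (v (Fin.last d)) := fun i => by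
      ext j; simp [toR, edges]
    simp only [Pi.add_apply, add_smul, Finset.sum_add_distrib]
    rw [hβ0, hx]
    simp [Fin.sum_univ_castSucc, hedge, smul_sub, Finset.sum_smul, ← sub_eq_add_neg]
  rw [hxe]
  refine sum_smul_mem_interior_hullOf hv (fun i => ?_) ?_
  · induction i using Fin.lastCases with
    | last => simpa using by linarith [hβ (Fin.last d)]
    | cast i => simpa using by linarith [(abs_lt.1 (ht i)).1]
  · simp only [Pi.add_apply, Finset.sum_add_distrib, hβ1]
    simp [Fin.sum_univ_castSucc]

/-- If a `d`-dimensional canonical lattice simplex has primitive vertices `v 0, …, v d`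
and reduced weights `λ 0, …, λ d` ordered so that `λ d` is minimal, then
`mult P * λ 0 ⋯ λ (d-1) ≤ h^(d-1)` where `h = λ 0 + ⋯ + λ d`. -/
theorem mult_mul_weights_le {d : ℕ} (v : Fin (d + 1) → Fin d → ℤ)
    (hv : IsCanonicalSimplex v)
    (hprim : ∀ i, Finset.univ.gcd (v i) = 1)
    (lam : Fin (d + 1) → ℕ) (hlampos : ∀ i, 0 < lam i)
    (hcop : Finset.univ.gcd lam = 1)
    (hrel : ∑ i, (lam i : ℤ) • v i = 0)
    (hord : ∀ i : Fin d, lam (Fin.last d) ≤ lam i.castSucc) :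
    mult v * ∏ i : Fin d, lam i.castSucc ≤ (∑ i, lam i) ^ (d - 1) := by
  by_contra! hlt
  set h := ∑ i, lam i with hh
  have hpos : 0 < h := Finset.sum_pos (fun i _ => hlampos i) Finset.univ_nonempty
  obtain ⟨hind, -, hcanon⟩ := hv
  have hd : d ≠ 0 := by
    rintro rfl
    simpa using hprim 0
  have hposR : (0 : ℝ) < h := mod_cast hpos
  set β : Fin (d + 1) → ℝ := fun i => lam i / h with hβdef
  have hβ : ∀ i, 0 < β i := fun i => div_pos (mod_cast hlampos i) hposR
  have hβ1 : ∑ i, β i = 1 := by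
    rw [hβdef, ← Finset.sum_div, div_eq_one_iff_eq hposR.ne', hh]
    push_cast
    rfl
  have hβ0 : ∑ i, β i • toR (v i) = 0 := by
    ext j
    have hj : ∑ i, (lam i : ℤ) * v i j = 0 := by simpa using congrFun hrel j
    have hjR : ∑ i, (lam i : ℝ) * v i j = 0 := mod_cast hj
    simp [hβdef, toR, div_mul_eq_mul_div, ← Finset.sum_div, hjR]
  have hvol : 1 < ((Matrix.of (edges v)).det.natAbs : ℝ) * ∏ i : Fin d, β i.castSucc := by
    have hnat : h ^ d < (Matrix.of (edges v)).det.natAbs * ∏ i : Fin d, lam i.castSucc :=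
      calc h ^ d = h * h ^ (d - 1) := (mul_pow_sub_one hd h).symm
        _ < h * (mult v * ∏ i : Fin d, lam i.castSucc) := Nat.mul_lt_mul_of_pos_left hlt hpos
        _ = h * mult v * ∏ i : Fin d, lam i.castSucc := (mul_assoc _ _ _).symm
        _ ≤ _ := Nat.mul_le_mul_right _ (sum_weights_mul_mult_le hind hcop hrel)
    simp only [hβdef, Finset.prod_div_distrib, Finset.prod_const, Finset.card_univ,
      Fintype.card_fin]
    rw [← mul_div_assoc, one_lt_div (by positivity)]
    exact_mod_cast hnat
  obtain ⟨x, hx0, t, ht, hx⟩ := exists_ne_zero_eq_sum_smul _ _ (fun i => hβ i.castSucc) hvol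
  rcases le_total (∑ i, t i) 0 with hs | hs
  · exact hx0 (hcanon x (mem_interior_hullOf_of_sum_nonpos hind hβ hβ1 hβ0 ht hx hs))
  · refine hx0 (neg_eq_zero.1 (hcanon (-x) (mem_interior_hullOf_of_sum_nonpos hind hβ hβ1 hβ0
      (t := -t) (by simpa using ht) ?_ (by simpa using hs))))
    have hneg : toR (-x) = -toR x := by ext; simp [toR]
    simp [hneg, hx]
end

section
/- Let P ⊂ ℝ^d be a d-dimensional reflexive lattice simplex with vertices v_0, …, v_d and reduced weights (λ_0, …, λ_d), and set h := λ_0 + ⋯ + λ_d. Then mult(P) · λ_0 ⋯ λ_d divides h^{d-1}. -/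
/-- `v` is the vertex family of a reflexive simplex: the vertices are affinely
independent, the origin is in the interior, and the dual polytope
`P* = {u : ⟨u, x⟩ ≥ -1 ∀ x ∈ P}` is the convex hull of finitely many lattice
points (equivalently, all its vertices are lattice points). -/
def IsReflexiveSimplex {d : ℕ} (v : Fin (d + 1) → Fin d → ℤ) : Prop :=
  AffineIndependent ℝ (fun i => toR (v i)) ∧
  (0 : Fin d → ℝ) ∈ interior (hullOf v) ∧
  ∃ F : Finset (Fin d → ℤ),
    {u : Fin d → ℝ | ∀ x ∈ hullOf v, -1 ≤ ∑ j, u j * x j}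
      = convexHull ℝ (toR '' (F : Set (Fin d → ℤ)))

open Finset Matrix

/-- If a multiple `n • w 0` lies in the lattice spanned by the other vectors of a family with
coprime relation weights `lam`, then `lam 0` divides `n`. -/
theorem dvd_of_nsmul_mem_closure_range_succ {d : ℕ} (w : Fin (d + 1) → Fin d → ℤ)
    (lam : Fin (d + 1) → ℕ) (hcop : univ.gcd lam = 1)
    (hrel : ∑ i, (lam i : ℤ) • w i = 0)
    (hdet : (of fun j : Fin d => w j.succ).det ≠ 0) (n : ℕ)
    (hn : n • w 0 ∈ AddSubgroup.closure (Set.range fun j : Fin d => w j.succ)) :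
    lam 0 ∣ n := by
  obtain ⟨c, hc⟩ := AddSubgroup.exists_of_mem_closure_range _ _ hn
  have hli : LinearIndependent ℤ fun j : Fin d => w j.succ :=
    linearIndependent_rows_of_det_ne_zero hdet
  rw [Fin.sum_univ_succ] at hrel
  have hneg := eq_neg_of_add_eq_zero_right hrel
  have hcoef : ∀ j : Fin d, (lam 0 : ℤ) * c j + n * lam j.succ = 0 := by
    refine Fintype.linearIndependent_iff.1 hli (fun j => (lam 0 : ℤ) * c j + n * lam j.succ) ?_
    have h1 : ((lam 0 : ℤ) * n) • w 0 = ∑ j : Fin d, ((lam 0 : ℤ) * c j) • w j.succ := by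
      rw [mul_smul, natCast_zsmul _ n, hc, smul_sum]
      simp [mul_smul]
    have h2 : ∑ j : Fin d, ((n : ℤ) * lam j.succ) • w j.succ = -(((lam 0 : ℤ) * n) • w 0) := by
      simp only [mul_smul]
      rw [← smul_sum, hneg, smul_neg, smul_comm]
    simp only [add_smul, sum_add_distrib]
    rw [h2, ← h1, add_neg_cancel]
  have hdvd : ∀ i, lam 0 ∣ n * lam i := by
    refine Fin.cases (dvd_mul_left _ _) fun j => ?_
    have : (lam 0 : ℤ) ∣ n * lam j.succ := ⟨-c j, by linear_combination hcoef j⟩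
    exact_mod_cast this
  have := Finset.dvd_gcd (s := univ) fun i _ => hdvd i
  rwa [Finset.gcd_mul_left, hcop, normalize_eq, mul_one] at this

/-- The index of the lattice spanned by `w`, times the weight `lam 0`, divides the determinant
of the remaining vectors. -/
theorem index_closure_range_mul_dvd_natAbs_det {d : ℕ} (w : Fin (d + 1) → Fin d → ℤ)
    (lam : Fin (d + 1) → ℕ) (hcop : univ.gcd lam = 1)
    (hrel : ∑ i, (lam i : ℤ) • w i = 0)
    (hdet : (of fun j : Fin d => w j.succ).det ≠ 0) :
    (AddSubgroup.closure (Set.range w)).index * lam 0 ∣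
      (of fun j : Fin d => w j.succ).det.natAbs := by
  set N := AddSubgroup.closure (Set.range w)
  set N₀ := AddSubgroup.closure (Set.range fun j : Fin d => w j.succ) with hN₀
  have hle : N₀ ≤ N := AddSubgroup.closure_mono (Set.range_comp_subset_range Fin.succ w)
  have hli : LinearIndependent ℤ fun j : Fin d => w j.succ :=
    linearIndependent_rows_of_det_ne_zero hdet
  have hindex : N₀.index = (of fun j : Fin d => w j.succ).det.natAbs := by
    have hspan : Submodule.span ℤ (Set.range fun j : Fin d => w j.succ) =
        AddSubgroup.toIntSubmodule N₀ := by
      rw [hN₀, AddSubgroup.toIntSubmodule_closure]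
    rw [AddSubgroup.index_eq_natAbs_det (Pi.basisFun ℤ (Fin d)) N₀
      ((Module.Basis.span hli).map (LinearEquiv.ofEq _ _ hspan)), Pi.basisFun_det_apply]
    congr 2
    ext i j
    exact congrFun (congrArg Subtype.val (Module.Basis.span_apply hli i)) j
  rw [← hindex, ← AddSubgroup.relIndex_mul_index hle, mul_comm]
  refine mul_dvd_mul_right ?_ _
  let x : N ⧸ N₀.addSubgroupOf N :=
    QuotientAddGroup.mk ⟨w 0, AddSubgroup.subset_closure (Set.mem_range_self 0)⟩
  refine dvd_trans ?_ (addOrderOf_dvd_natCard x)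
  refine dvd_of_nsmul_mem_closure_range_succ w lam hcop hrel hdet _ ?_
  have := addOrderOf_nsmul_eq_zero x
  rwa [← QuotientAddGroup.mk_nsmul, QuotientAddGroup.eq_zero_iff,
    AddSubgroup.mem_addSubgroupOf] at this

/-- Determinant of a diagonal matrix minus the all-ones matrix, with denominators cleared. -/
theorem det_diagonal_sub_one_mul_prod {d : ℕ} (hd : 0 < d) (a lam : Fin d → ℤ) (l h : ℤ)
    (ha : ∀ i, a i * lam i = h) (hsum : l + ∑ i, lam i = h) :
    (diagonal a - of fun _ _ => 1).det * ∏ i, lam i = l * h ^ (d - 1) := by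
  have hdet : (diagonal a - of fun _ _ => 1).det * ∏ i, lam i =
      (scalar (Fin d) h - vecMulVec lam 1).det := by
    rw [mul_comm, ← det_diagonal, ← det_mul]
    congr 1
    ext i j
    rw [diagonal_mul, scalar_apply]
    by_cases hij : i = j
    · subst hij
      simp [mul_sub, ← ha i, mul_comm]
    · simp [hij]
  obtain ⟨e, rfl⟩ := Nat.exists_eq_succ_of_ne_zero hd.ne'
  rw [hdet, ← eval_charpoly, charpoly_vecMulVec]
  simp only [Polynomial.eval_sub, Polynomial.eval_smul, Polynomial.eval_pow, Polynomial.eval_X,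
    Fintype.card_fin, dotProduct_one, smul_eq_mul, Nat.succ_sub_one]
  rw [pow_succ]
  linear_combination -(h ^ e) * hsum

/-- Dropping one vertex of an affinely independent family with a positive linear relation leaves
a linearly independent family. -/
theorem linearIndependent_toR_succAbove {d : ℕ} (v : Fin (d + 1) → Fin d → ℤ)
    (hv : AffineIndependent ℝ fun i => toR (v i))
    (lam : Fin (d + 1) → ℕ) (hlampos : ∀ i, 0 < lam i)
    (hrel : ∑ i, (lam i : ℝ) • toR (v i) = 0) (i : Fin (d + 1)) :
    LinearIndependent ℝ fun j : Fin d => toR (v (i.succAbove j)) := by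
  rw [Fintype.linearIndependent_iff]
  intro c hc
  have hH : (0 : ℝ) < ∑ k, (lam k : ℝ) :=
    sum_pos (fun k _ => by exact_mod_cast hlampos k) univ_nonempty
  set H := ∑ k, (lam k : ℝ) with hHdef
  set t : ℝ := (∑ j, c j) / H with ht
  have key := affineIndependent_iff.1 hv univ
    (fun k => i.insertNth (α := fun _ => ℝ) 0 c k - t * lam k)
    (by
      rw [sum_sub_distrib, ← mul_sum, ← hHdef, Fin.sum_univ_succAbove _ i]
      simp [ht, hH.ne'])
    (by
      simp only [sub_smul, mul_smul]
      rw [sum_sub_distrib, ← smul_sum, hrel, Fin.sum_univ_succAbove _ i]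
      simp [hc])
  have ht0 : t = 0 := by
    have := key i (mem_univ i)
    simpa [(hlampos i).ne'] using this
  intro j
  simpa [ht0] using key (i.succAbove j) (mem_univ _)

/-- The vertex of the dual polytope opposite to `v i` is a lattice point. -/
theorem exists_int_dual_vertex {d : ℕ} (v : Fin (d + 1) → Fin d → ℤ)
    (hv : IsReflexiveSimplex v)
    (lam : Fin (d + 1) → ℕ) (hlampos : ∀ i, 0 < lam i)
    (hrel : ∑ i, (lam i : ℝ) • toR (v i) = 0) (i : Fin (d + 1)) :
    ∃ f : Fin d → ℤ, ∀ j, j ≠ i → f ⬝ᵥ v j = -1 := by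
  obtain ⟨haff, -, F, hF⟩ := hv
  have hmem : ∀ u : Fin d → ℝ, u ∈ convexHull ℝ (toR '' (F : Set (Fin d → ℤ))) ↔
      ∀ j, -1 ≤ u ⬝ᵥ toR (v j) := by
    intro u
    rw [← hF]
    refine ⟨fun hu j => hu _ (subset_convexHull ℝ _ (Set.mem_range_self j)), fun hu => ?_⟩
    have hconv : Convex ℝ {x : Fin d → ℝ | -1 ≤ u ⬝ᵥ x} :=
      convex_halfSpace_ge ⟨dotProduct_add u, fun c x => dotProduct_smul c u x⟩ _
    exact convexHull_min (by rintro _ ⟨j, rfl⟩; exact hu j) hconv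
  let M : Matrix (Fin d) (Fin d) ℝ := of fun j => toR (v (i.succAbove j))
  have hM : IsUnit M :=
    linearIndependent_rows_iff_isUnit.1
      (linearIndependent_toR_succAbove v haff lam hlampos hrel i)
  obtain ⟨u, hu⟩ := (mulVec_surjective_iff_isUnit.2 hM) (fun _ => -1)
  have hu' : ∀ j, u ⬝ᵥ toR (v (i.succAbove j)) = -1 := fun j => by
    rw [dotProduct_comm]; exact congrFun hu j
  have huF : u ∈ convexHull ℝ (toR '' (F : Set (Fin d → ℤ))) := by
    rw [hmem, Fin.forall_iff_succAbove i]
    refine ⟨?_, fun j => (hu' j).ge⟩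
    have h0 : u ⬝ᵥ ∑ i, (lam i : ℝ) • toR (v i) = 0 := by rw [hrel, dotProduct_zero]
    rw [dotProduct_sum, Fin.sum_univ_succAbove _ i] at h0
    simp only [dotProduct_smul, hu', smul_eq_mul] at h0
    have hpos : (0 : ℝ) < lam i := by exact_mod_cast hlampos i
    have hnn : (0 : ℝ) ≤ ∑ j, (lam (i.succAbove j) : ℝ) := sum_nonneg fun _ _ => Nat.cast_nonneg _
    rw [← sum_mul] at h0
    have : 0 ≤ u ⬝ᵥ toR (v i) := by
      by_contra! hneg
      nlinarith
    linarith
  have hconc : ConvexOn ℝ (convexHull ℝ (toR '' (F : Set (Fin d → ℤ))))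
      (fun x : Fin d → ℝ => x ⬝ᵥ (-∑ j, toR (v (i.succAbove j)))) :=
    (LinearMap.convexOn
      ((dotProductBilin ℝ ℝ).flip (-∑ j, toR (v (i.succAbove j)))) (convex_convexHull ℝ _))
  obtain ⟨_, ⟨f, hf, rfl⟩, hle⟩ := hconc.exists_ge_of_mem_convexHull (subset_convexHull ℝ _) huF
  refine ⟨f, fun j hj => ?_⟩
  have hge := (hmem (toR f)).1 (subset_convexHull ℝ _ ⟨f, hf, rfl⟩)
  simp only [dotProduct_neg, dotProduct_sum, hu', neg_le_neg_iff] at hle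
  obtain ⟨k, rfl⟩ := Fin.exists_succAbove_eq hj
  have heq := (sum_eq_sum_iff_of_le (s := univ) (f := fun _ : Fin d => (-1 : ℝ))
    fun k _ => hge (i.succAbove k)).1 (le_antisymm (sum_le_sum fun k _ => hge _) hle) k (mem_univ k)
  have hcast : ((f ⬝ᵥ v (i.succAbove k) : ℤ) : ℝ) = -1 := by
    rw [heq]
    simp [dotProduct, toR]
  exact_mod_cast hcast

/-- If a `d`-dimensional reflexive lattice simplex has reduced weights
`λ 0, …, λ d` with `h = λ 0 + ⋯ + λ d`, then `mult P * λ 0 ⋯ λ d` divides `h^(d-1)`. -/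
theorem mult_mul_weights_dvd_of_reflexive {d : ℕ} (v : Fin (d + 1) → Fin d → ℤ)
    (hv : IsReflexiveSimplex v)
    (lam : Fin (d + 1) → ℕ) (hlampos : ∀ i, 0 < lam i)
    (hcop : Finset.univ.gcd lam = 1)
    (hrel : ∑ i, (lam i : ℤ) • v i = 0) :
    mult v * ∏ i, lam i ∣ (∑ i, lam i) ^ (d - 1) := by
  rcases Nat.eq_zero_or_pos d with rfl | hd
  · have h0 : lam 0 = 1 := by simpa using hcop
    have h1 : AddSubgroup.closure (Set.range v) = ⊤ := Subsingleton.elim _ _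
    simp [mult, h0, h1]
  have hrelR : ∑ i, (lam i : ℝ) • toR (v i) = 0 := by
    ext j
    have := congrFun hrel j
    simp only [Finset.sum_apply, Pi.smul_apply, smul_eq_mul, Pi.zero_apply] at this ⊢
    simp only [toR]
    exact_mod_cast this
  choose u hu using exists_int_dual_vertex v hv lam hlampos hrelR
  set h : ℕ := ∑ i, lam i with hh
  have hhpos : 0 < h := sum_pos (fun i _ => hlampos i) univ_nonempty
  have hdiag : ∀ i, (u i ⬝ᵥ v i + 1) * lam i = (h : ℤ) := by
    intro i
    have h0 : u i ⬝ᵥ ∑ k, (lam k : ℤ) • v k = 0 := by rw [hrel, dotProduct_zero]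
    rw [dotProduct_sum, Fin.sum_univ_succAbove _ i] at h0
    simp only [dotProduct_smul, hu i _ (Fin.succAbove_ne i _), smul_eq_mul, mul_neg, mul_one,
      sum_neg_distrib] at h0
    rw [hh, Fin.sum_univ_succAbove _ i]
    push_cast
    linear_combination h0
  set U : Matrix (Fin d) (Fin d) ℤ := of fun j => u j.succ
  set V : Matrix (Fin d) (Fin d) ℤ := of fun j => v j.succ
  have hUV : U * Vᵀ = diagonal (fun j : Fin d => u j.succ ⬝ᵥ v j.succ + 1) - of fun _ _ => 1 := by
    ext i j
    change u i.succ ⬝ᵥ v j.succ = _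
    by_cases hij : i = j
    · subst hij
      simp
    · simp [hij, hu i.succ j.succ (fun e => hij (Fin.succ_injective _ e).symm)]
  have hdet : U.det * V.det * ∏ i, (lam i : ℤ) = (lam 0 : ℤ) ^ 2 * (h : ℤ) ^ (d - 1) := by
    have key := det_diagonal_sub_one_mul_prod hd (fun j : Fin d => u j.succ ⬝ᵥ v j.succ + 1)
      (fun j => (lam j.succ : ℤ)) (lam 0) h (fun j => hdiag j.succ)
      (by rw [hh, Fin.sum_univ_succ]; push_cast; rfl)
    rw [← hUV, det_mul, det_transpose] at key
    rw [Fin.prod_univ_succ]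
    linear_combination (lam 0 : ℤ) * key
  have hne : U.det * V.det ≠ 0 := by
    intro h0
    rw [h0, zero_mul] at hdet
    have h1 := hlampos 0
    have : (0 : ℤ) < (lam 0 : ℤ) ^ 2 * (h : ℤ) ^ (d - 1) := by positivity
    exact this.ne hdet
  have hU := left_ne_zero_of_mul hne
  have hV := right_ne_zero_of_mul hne
  have hrelU : ∑ i, (lam i : ℤ) • u i = 0 := by
    refine eq_zero_of_mulVec_eq_zero hV ?_
    ext j
    change v j.succ ⬝ᵥ _ = 0
    rw [dotProduct_sum, Fin.sum_univ_succAbove _ j.succ]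
    simp only [smul_dotProduct, dotProduct_comm (v j.succ), hu _ _ (Fin.succAbove_ne j.succ _).symm,
      smul_eq_mul, mul_neg, mul_one, sum_neg_distrib]
    have := hdiag j.succ
    rw [hh, Fin.sum_univ_succAbove _ j.succ] at this
    push_cast at this
    linear_combination this
  have hdvdV : mult v * lam 0 ∣ V.det.natAbs :=
    index_closure_range_mul_dvd_natAbs_det v lam hcop hrel hV
  have hdvdU : lam 0 ∣ U.det.natAbs :=
    (dvd_mul_left _ _).trans (index_closure_range_mul_dvd_natAbs_det u lam hcop hrelU hU)
  have hnat : U.det.natAbs * V.det.natAbs * ∏ i, lam i = lam 0 ^ 2 * h ^ (d - 1) := by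
    have := congrArg Int.natAbs hdet
    rw [← Nat.cast_prod] at this
    simpa only [Int.natAbs_mul, Int.natAbs_pow, Int.natAbs_natCast] using this
  have h1 := hlampos 0
  refine Nat.dvd_of_mul_dvd_mul_left (pow_pos h1 2) ?_
  rw [← hnat]
  calc lam 0 ^ 2 * (mult v * ∏ i, lam i) = lam 0 * (mult v * lam 0) * ∏ i, lam i := by ring
    _ ∣ _ := mul_dvd_mul_right (mul_dvd_mul hdvdU hdvdV) _
end

section
/- Let P ⊂ ℝ² be a 2-dimensional lattice polytope such that the origin lies in the interior of P and is the only lattice point in the interior of P. Then Vol(P) ≤ 9, with equality if and only if P is unimodularly equivalent to conv{0, 3e_1, 3e_2} − (1,1). -/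
/-- The closure properties of the set of lattice points of a convex lattice polygon whose only
interior lattice point is the origin, written as a binary predicate on coordinates. -/
structure IsCanonicalSet (S : ℤ → ℤ → Prop) : Prop where
  mem_of_combo : ∀ {a b c d : ℤ} (m n k x y : ℤ), S a b → S c d → 0 < m → 0 ≤ n → 0 ≤ k →
    n + k ≤ m → m * x = n * a + k * c → m * y = n * b + k * d → S x y
  eq_zero_of_combo : ∀ {a b c d : ℤ} (m n k x y : ℤ), S a b → S c d → 0 ≤ n → 0 ≤ k →
    n + k < m → m * x = n * a + k * c → m * y = n * b + k * d → x = 0 ∧ y = 0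
  exists_pos : ∀ p q : ℤ, (p ≠ 0 ∨ q ≠ 0) → ∃ a b, S a b ∧ 0 < p * a + q * b

namespace IsCanonicalSet

variable {S : ℤ → ℤ → Prop}

theorem comp (h : IsCanonicalSet S) {p q r s : ℤ} (hdet : p * s - q * r = 1) :
    IsCanonicalSet fun a b => S (p * a + q * b) (r * a + s * b) where
  mem_of_combo m n k x y h₁ h₂ hm hn hk hle hx hy :=
    h.mem_of_combo m n k _ _ h₁ h₂ hm hn hk hle
      (by linear_combination p * hx + q * hy) (by linear_combination r * hx + s * hy)
  eq_zero_of_combo m n k x y h₁ h₂ hn hk hlt hx hy := by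
    obtain ⟨h₃, h₄⟩ := h.eq_zero_of_combo m n k (p * x + q * y) (r * x + s * y) h₁ h₂ hn hk hlt
      (by linear_combination p * hx + q * hy) (by linear_combination r * hx + s * hy)
    exact ⟨by linear_combination s * h₃ - q * h₄ - x * hdet,
      by linear_combination p * h₄ - r * h₃ - y * hdet⟩
  exists_pos u v huv := by
    obtain ⟨a, b, hab, hpos⟩ := h.exists_pos (u * s - v * r) (v * p - u * q) (by
      by_contra! hcon
      obtain ⟨h₁, h₂⟩ := hcon
      have hu : u = 0 := by linear_combination p * h₁ + r * h₂ - u * hdet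
      have hv : v = 0 := by linear_combination q * h₁ + s * h₂ - v * hdet
      simp [hu, hv] at huv)
    refine ⟨s * a - q * b, p * b - r * a, ?_, by linarith⟩
    convert hab using 1
    · linear_combination a * hdet
    · linear_combination b * hdet

theorem abs_le_one (h : IsCanonicalSet S) {a : ℤ} (ha : S a 0) : -1 ≤ a ∧ a ≤ 1 := by
  constructor <;> by_contra! hlt
  · have := h.eq_zero_of_combo (-a) 1 0 (-1) 0 ha ha (by simp) le_rfl (by omega) (by ring) (by ring)
    omega
  · have := h.eq_zero_of_combo a 1 0 1 0 ha ha (by simp) le_rfl (by omega) (by ring) (by ring)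
    omega

/-- A horizontal chord below the axis with lattice length at least three is at height `-1`. -/
theorem height_eq_neg_one (h : IsCanonicalSet S) {a b g : ℤ} (hg : 0 < g) (hb : b < 0)
    (h₁ : S a b) (h₂ : S (a + 3 * g) b) : b = -1 := by
  by_contra hne
  obtain ⟨t, rfl⟩ : ∃ t, b = -t := ⟨-b, by ring⟩
  have ht : 2 ≤ t := by omega
  set x := -((-((t - 1) * a)) / t) with hx
  have e₁ := Int.emod_add_mul_ediv (-((t - 1) * a)) t
  have e₂ := Int.emod_nonneg (-((t - 1) * a)) (by omega : t ≠ 0)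
  have e₃ := Int.emod_lt_of_pos (-((t - 1) * a)) (by omega : 0 < t)
  set ρ := (-((t - 1) * a)) % t
  have e₄ : t * x = (t - 1) * a + ρ := by rw [hx]; linarith
  have key := h.eq_zero_of_combo (3 * g * t) (3 * g * (t - 1) - ρ) ρ x (-(t - 1)) h₁ h₂
    (by nlinarith) e₂ (by nlinarith) (by linear_combination 3 * g * e₄) (by ring)
  omega

/-- Two distinct nonzero lattice points that agree modulo three can be moved to a chord of
lattice length at least three at height `-1`. -/
theorem exists_normalized_chord (h : IsCanonicalSet S) {a b c d : ℤ} (h₁ : S a b) (h₂ : S c d)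
    (hab : a ≠ 0 ∨ b ≠ 0) (hcd : c ≠ 0 ∨ d ≠ 0) (hne : a ≠ c ∨ b ≠ d)
    (h3a : 3 ∣ c - a) (h3b : 3 ∣ d - b) :
    ∃ p q r s : ℤ, p * s - q * r = 1 ∧ S (p * -1 + q * -1) (r * -1 + s * -1) ∧
      S (p * 2 + q * -1) (r * 2 + s * -1) := by
  obtain ⟨e, he⟩ := h3a
  obtain ⟨f, hf⟩ := h3b
  have hef : e ≠ 0 ∨ f ≠ 0 := by omega
  have hg : 0 < (Int.gcd e f : ℤ) := by
    have := Int.gcd_pos_iff.2 hef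
    exact_mod_cast this
  obtain ⟨p, hp⟩ := Int.gcd_dvd_left e f
  obtain ⟨r, hr⟩ := Int.gcd_dvd_right e f
  have hbez := Int.gcd_eq_gcd_ab e f
  set g : ℤ := (Int.gcd e f : ℤ)
  set s := Int.gcdA e f
  obtain ⟨q, hq⟩ : ∃ q, q = -Int.gcdB e f := ⟨_, rfl⟩
  have hdet : p * s - q * r = 1 := by
    have : g * (p * s - q * r) = g * 1 := by
      rw [hq]
      linear_combination -hbez - hp * s - hr * Int.gcdB e f
    exact mul_left_cancel₀ hg.ne' this
  have aux : ∀ (p q r s x y : ℤ), p * s - q * r = 1 → y < 0 → S (p * x + q * y) (r * x + s * y) →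
      S (p * (x + 3 * g) + q * y) (r * (x + 3 * g) + s * y) →
      ∃ p q r s : ℤ, p * s - q * r = 1 ∧ S (p * -1 + q * -1) (r * -1 + s * -1) ∧
        S (p * 2 + q * -1) (r * 2 + s * -1) := by
    intro p q r s x y hdet hy hx hx'
    obtain rfl := (h.comp hdet).height_eq_neg_one hg hy hx hx'
    refine ⟨p, q + p * (-1 - x), r, s + r * (-1 - x), by linear_combination hdet, ?_, ?_⟩
    · convert hx using 1 <;> ring
    · refine h.mem_of_combo g (g - 1) 1 _ _ hx hx' hg (by omega) (by simp) (by omega) ?_ ?_ <;> ring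
  have ha' : a = p * (s * a - q * b) + q * (p * b - r * a) := by linear_combination -a * hdet
  have hb' : b = r * (s * a - q * b) + s * (p * b - r * a) := by linear_combination -b * hdet
  have hc' : c = p * (s * a - q * b + 3 * g) + q * (p * b - r * a) := by
    linear_combination he + 3 * hp - a * hdet
  have hd' : d = r * (s * a - q * b + 3 * g) + s * (p * b - r * a) := by
    linear_combination hf + 3 * hr - b * hdet
  generalize s * a - q * b = x at *
  generalize p * b - r * a = y at *
  subst ha' hb' hc' hd'
  rcases lt_trichotomy y 0 with hy | rfl | hy
  · exact aux p q r s x y hdet hy h₁ h₂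
  · have k₁ := (h.comp hdet).abs_le_one h₁
    have k₂ := (h.comp hdet).abs_le_one h₂
    have : x = -1 := by omega
    have : 3 * g = 2 := by
      have : x + 3 * g ≠ 0 := by
        intro h0
        simp [h0] at hcd
      omega
    omega
  · refine aux (-p) (-q) (-r) (-s) (-x - 3 * g) (-y) (by linarith) (by omega) ?_ ?_
    · convert h₂ using 1 <;> ring
    · convert h₁ using 1 <;> ring

/-- If the chord from `(-1, -1)` to `(2, -1)` is present, there are at most eight nonzero lattice
points unless `(-1, 2)` is also present, in which case they lie in a triangle. -/
theorem card_le_or_subset_triangle (h : IsCanonicalSet S) (h₁ : S (-1) (-1)) (h₂ : S 2 (-1)) :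
    (∃ l : Finset (ℤ × ℤ), l.card ≤ 8 ∧ ∀ a b, S a b → (a ≠ 0 ∨ b ≠ 0) → (a, b) ∈ l) ∨
      S (-1) 2 ∧ ∀ a b, S a b → -1 ≤ a ∧ -1 ≤ b ∧ a + b ≤ 1 := by
  have hbelow : ∀ x y, S x y → -1 ≤ y := by
    intro x y hxy
    by_contra! hy
    rcases le_total 0 x with hx | hx
    · have := h.eq_zero_of_combo (-y + x) 1 x 0 (-1) hxy h₁ (by simp) hx (by omega)
        (by ring) (by ring)
      omega
    · have := h.eq_zero_of_combo (-2 * y - x) 2 (-x) 0 (-1) hxy h₂ (by simp) (by omega) (by omega)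
        (by ring) (by ring)
      omega
  have hleft : ∀ x y, S x y → 0 ≤ y → -1 ≤ x := by
    intro x y hxy hy
    by_contra! hx
    have := h.eq_zero_of_combo (y - x) 1 y (-1) 0 hxy h₁ (by simp) hy (by omega) (by ring) (by ring)
    omega
  have hright : ∀ x y, S x y → 0 ≤ y → x + y ≤ 1 := by
    intro x y hxy hy
    by_contra! hx
    have := h.eq_zero_of_combo (x + 2 * y) 1 y 1 0 hxy h₂ (by simp) hy (by omega)
      (by ring) (by ring)
    omega
  by_cases hapex : S (-1) 2
  · refine Or.inr ⟨hapex, fun x y hxy => ?_⟩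
    have hy := hbelow x y hxy
    rcases hy.eq_or_lt with rfl | hy'
    · refine ⟨?_, le_rfl, ?_⟩
      · by_contra! hx
        have := h.eq_zero_of_combo (1 - 2 * x) 1 2 (-1) 0 hapex hxy (by simp) (by simp) (by omega)
          (by ring) (by ring)
        omega
      · by_contra! hx
        have := h.eq_zero_of_combo (2 * x - 1) 1 2 1 0 hapex hxy (by simp) (by simp) (by omega)
          (by ring) (by ring)
        omega
    · exact ⟨hleft x y hxy (by omega), hy, hright x y hxy (by omega)⟩
  left
  have hcases : ∀ x y, S x y → (x ≠ 0 ∨ y ≠ 0) →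
      y = -1 ∨ (x, y) = (-1, 0) ∨ (x, y) = (1, 0) ∨ (x, y) = (-1, 1) ∨ (x, y) = (0, 1) := by
    intro x y hxy hne
    have hy := hbelow x y hxy
    have hx := hleft x y hxy
    have hx' := hright x y hxy
    have : ¬ (x = -1 ∧ y = 2) := by
      rintro ⟨rfl, rfl⟩
      exact hapex hxy
    simp only [Prod.mk.injEq]
    omega
  have hbound₁ : S (-1) 1 → ∀ x, S x (-1) → -1 ≤ x ∧ x ≤ 3 := by
    intro h₃ x hx
    constructor <;> by_contra! hlt
    · have := h.eq_zero_of_combo (1 - x) 1 1 (-1) 0 h₃ hx (by simp) (by simp) (by omega)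
        (by ring) (by ring)
      omega
    · have := h.eq_zero_of_combo (x - 1) 1 1 1 0 h₃ hx (by simp) (by simp) (by omega)
        (by ring) (by ring)
      omega
  have hbound₂ : S 0 1 → ∀ x, S x (-1) → -2 ≤ x ∧ x ≤ 2 := by
    intro h₃ x hx
    constructor <;> by_contra! hlt
    · have := h.eq_zero_of_combo (-x) 1 1 (-1) 0 h₃ hx (by simp) (by simp) (by omega)
        (by ring) (by ring)
      omega
    · have := h.eq_zero_of_combo x 1 1 1 0 h₃ hx (by simp) (by simp) (by omega)
        (by ring) (by ring)
      omega
  by_cases h₃ : S (-1) 1 <;> by_cases h₄ : S 0 1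
  · refine ⟨{(-1, 0), (1, 0), (-1, 1), (0, 1), (-1, -1), (0, -1), (1, -1), (2, -1)}, by decide,
      fun x y hxy hne => ?_⟩
    rcases hcases x y hxy hne with rfl | he | he | he | he
    · have := hbound₁ h₃ x hxy
      have := hbound₂ h₄ x hxy
      simp
      omega
    all_goals simp [he]
  · refine ⟨{(-1, 0), (1, 0), (-1, 1), (-1, -1), (0, -1), (1, -1), (2, -1), (3, -1)}, by decide,
      fun x y hxy hne => ?_⟩
    rcases hcases x y hxy hne with rfl | he | he | he | he
    · have := hbound₁ h₃ x hxy
      simp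
      omega
    any_goals simp [he]
    simp only [Prod.mk.injEq] at he
    exact h₄ (by rwa [he.1, he.2] at hxy)
  · refine ⟨{(-1, 0), (1, 0), (0, 1), (-2, -1), (-1, -1), (0, -1), (1, -1), (2, -1)}, by decide,
      fun x y hxy hne => ?_⟩
    rcases hcases x y hxy hne with rfl | he | he | he | he
    · have := hbound₂ h₄ x hxy
      simp
      omega
    any_goals simp [he]
    simp only [Prod.mk.injEq] at he
    exact h₃ (by rwa [he.1, he.2] at hxy)
  · exfalso
    obtain ⟨x, y, hxy, hpos⟩ := h.exists_pos 0 1 (by simp)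
    rcases hcases x y hxy (by omega) with rfl | he | he | he | he
    · omega
    all_goals
      simp only [Prod.mk.injEq] at he
      obtain ⟨rfl, rfl⟩ := he
      first | omega | exact h₃ hxy | exact h₄ hxy

/-- A canonical set has at most eight nonzero points, or it is unimodularly equivalent to a set
of lattice points of the triangle with vertices `(-1, -1)`, `(2, -1)`, `(-1, 2)`. -/
theorem classification (h : IsCanonicalSet S) {l₀ : Finset (ℤ × ℤ)}
    (hl₀ : ∀ v, v ∈ l₀ ↔ S v.1 v.2 ∧ v ≠ 0) :
    l₀.card ≤ 8 ∨ ∃ p q r s : ℤ, p * s - q * r = 1 ∧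
      S (p * -1 + q * -1) (r * -1 + s * -1) ∧ S (p * 2 + q * -1) (r * 2 + s * -1) ∧
      S (p * -1 + q * 2) (r * -1 + s * 2) ∧
      ∀ a b, S (p * a + q * b) (r * a + s * b) → -1 ≤ a ∧ -1 ≤ b ∧ a + b ≤ 1 := by
  by_cases hinj : Set.InjOn (fun v : ℤ × ℤ => ((v.1 : ZMod 3), (v.2 : ZMod 3))) l₀
  · left
    have hmaps : Set.MapsTo (fun v : ℤ × ℤ => ((v.1 : ZMod 3), (v.2 : ZMod 3))) l₀
        (Finset.univ.erase (0 : ZMod 3 × ZMod 3)) := by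
      rintro ⟨a, b⟩ hv
      obtain ⟨hS, hne⟩ := (hl₀ _).1 hv
      simp only [Finset.coe_erase, Finset.coe_univ, Set.mem_sdiff, Set.mem_univ, true_and,
        Set.mem_singleton_iff, Prod.mk_eq_zero]
      rintro ⟨ha, hb⟩
      obtain ⟨a', rfl⟩ := (ZMod.intCast_zmod_eq_zero_iff_dvd a 3).1 ha
      obtain ⟨b', rfl⟩ := (ZMod.intCast_zmod_eq_zero_iff_dvd b 3).1 hb
      have := h.eq_zero_of_combo 3 1 0 a' b' hS hS (by simp) le_rfl (by simp) (by simp) (by simp)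
      simp [this] at hne
    exact (Finset.card_le_card_of_injOn _ hmaps hinj).trans (by decide)
  · simp only [Set.InjOn, not_forall] at hinj
    obtain ⟨⟨a, b⟩, hv, ⟨c, d⟩, hw, heq, hne⟩ := hinj
    obtain ⟨hS, hne₁⟩ := (hl₀ _).1 hv
    obtain ⟨hS', hne₂⟩ := (hl₀ _).1 hw
    simp only [Prod.mk.injEq, ne_eq, Prod.mk_eq_zero, ZMod.intCast_eq_intCast_iff_dvd_sub]
      at heq hne hne₁ hne₂
    obtain ⟨p, q, r, s, hdet, h₁, h₂⟩ := h.exists_normalized_chord hS hS' (by tauto) (by tauto)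
      (by tauto) (by exact_mod_cast heq.1) (by exact_mod_cast heq.2)
    rcases (h.comp hdet).card_le_or_subset_triangle h₁ h₂ with ⟨l, hl, hmem⟩ | ⟨h₃, hsub⟩
    · left
      refine (Finset.card_le_card_of_injOn
        (fun v : ℤ × ℤ => (s * v.1 - q * v.2, p * v.2 - r * v.1)) ?_ ?_).trans hl
      · rintro ⟨x, y⟩ hxy
        obtain ⟨hS₁, hne₃⟩ := (hl₀ _).1 hxy
        refine hmem _ _ ?_ ?_
        · convert hS₁ using 1
          · linear_combination x * hdet
          · linear_combination y * hdet
        · by_contra! hcon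
          refine hne₃ (Prod.ext ?_ ?_)
          · show x = 0
            linear_combination p * hcon.1 + q * hcon.2 - x * hdet
          · show y = 0
            linear_combination r * hcon.1 + s * hcon.2 - y * hdet
      · rintro ⟨x, y⟩ - ⟨x', y'⟩ - hxy
        simp only [Prod.mk.injEq] at hxy ⊢
        exact ⟨by linear_combination p * hxy.1 + q * hxy.2 - (x - x') * hdet,
          by linear_combination r * hxy.1 + s * hxy.2 - (y - y') * hdet⟩
    · exact Or.inr ⟨p, q, r, s, hdet, h₁, h₂, h₃, hsub⟩

theorem isCoprime (h : IsCanonicalSet S) {a b : ℤ} (hS : S a b) (hab : a ≠ 0 ∨ b ≠ 0) :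
    IsCoprime a b := by
  rw [Int.isCoprime_iff_gcd_eq_one]
  have hg := Int.gcd_pos_iff.2 hab
  by_contra hne
  obtain ⟨a', ha⟩ := Int.gcd_dvd_left a b
  obtain ⟨b', hb⟩ := Int.gcd_dvd_right a b
  have := h.eq_zero_of_combo (Int.gcd a b) 1 0 a' b' hS hS (by simp) le_rfl (by omega)
    (by linarith) (by linarith)
  rw [this.1, mul_zero] at ha
  rw [this.2, mul_zero] at hb
  omega

/-- Every nonzero point `w` of a finite canonical set has a neighbour `u` such that `u, w` is a
positively oriented lattice basis and `u + w` is outside the set. -/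
theorem exists_neighbor (h : IsCanonicalSet S) {l₀ : Finset (ℤ × ℤ)}
    (hl₀ : ∀ v, v ∈ l₀ ↔ S v.1 v.2 ∧ v ≠ 0) {a b : ℤ} (hS : S a b) (hab : a ≠ 0 ∨ b ≠ 0) :
    ∃ c d, S c d ∧ c * b - d * a = 1 ∧ ¬ S (c + a) (d + b) := by
  have hex : ∃ c d, S c d ∧ c * b - d * a = 1 := by
    obtain ⟨c, d, hcd, hpos⟩ := h.exists_pos b (-a) (by omega)
    obtain ⟨f, e, hef⟩ := h.isCoprime hS hab
    obtain ⟨D, hD⟩ : ∃ D, D = b * c + -a * d := ⟨_, rfl⟩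
    rw [← hD] at hpos
    have h₁ := Int.emod_add_mul_ediv (f * c + e * d) D
    have h₂ := Int.emod_nonneg (f * c + e * d) hpos.ne'
    have h₃ := Int.emod_lt_of_pos (f * c + e * d) hpos
    generalize (f * c + e * d) % D = k at *
    generalize (f * c + e * d) / D = j at *
    rcases h₂.eq_or_lt with rfl | hk
    · have hc : c = D * (e + j * a) := by
        linear_combination -c * hef - e * hD - a * h₁
      have hd : d = D * (-f + j * b) := by
        linear_combination -d * hef + f * hD - b * h₁
      by_cases hD1 : D = 1
      · exact ⟨c, d, hcd, by linarith⟩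
      · have := h.eq_zero_of_combo D 1 0 (e + j * a) (-f + j * b) hcd hcd (by simp) le_rfl
          (by omega) (by linarith) (by linarith)
        rw [this.1, mul_zero] at hc
        rw [this.2, mul_zero] at hd
        simp [hc, hd] at hD
        omega
    · refine ⟨e + (j + 1) * a, -f + (j + 1) * b, ?_, by linear_combination hef⟩
      refine h.mem_of_combo D 1 (D - k) _ _ hcd hS hpos (by simp) (by omega) (by omega) ?_ ?_
      · linear_combination a * h₁ + e * hD + c * hef
      · linear_combination b * h₁ - f * hD + d * hef
  obtain ⟨c, d, hcd, hdet⟩ := hex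
  obtain ⟨⟨x, y⟩, hxy, hmax⟩ := Finset.exists_max_image
    (l₀.filter fun v => v.1 * b - v.2 * a = 1) (fun v => v.1 * a + v.2 * b)
    ⟨(c, d), Finset.mem_filter.2 ⟨(hl₀ _).2 ⟨hcd, by rintro ⟨⟩; simp at hdet⟩, hdet⟩⟩
  rw [Finset.mem_filter, hl₀] at hxy
  refine ⟨x, y, hxy.1.1, hxy.2, fun hS' => ?_⟩
  have hdet' : (x + a) * b - (y + b) * a = 1 := by linear_combination hxy.2
  have := hmax (x + a, y + b) (Finset.mem_filter.2 ⟨(hl₀ _).2 ⟨hS', fun h0 => by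
    simp only [Prod.mk_eq_zero] at h0
    simp [h0.1, h0.2] at hdet'⟩, hdet'⟩)
  have h₁ : 0 < a * a + b * b := by
    rcases hab with h0 | h0 <;>
      linarith [mul_self_pos.2 h0, mul_self_nonneg a, mul_self_nonneg b]
  simp only at this
  nlinarith

/-- The line through a neighbouring pair supports the set. -/
theorem sum_coords_le_one (h : IsCanonicalSet S) {a b c d x y : ℤ} (hw : S a b) (hu : S c d)
    (hdet : c * b - d * a = 1) (hn : ¬ S (c + a) (d + b)) (hxy : S x y) :
    (x * b - y * a) + (c * y - d * x) ≤ 1 := by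
  have hx : x = (x * b - y * a) * c + (c * y - d * x) * a := by linear_combination -x * hdet
  have hy : y = (x * b - y * a) * d + (c * y - d * x) * b := by linear_combination -y * hdet
  generalize x * b - y * a = s at *
  generalize c * y - d * x = t at *
  by_contra! hst
  rcases le_or_gt t 0 with ht | ht
  · have := h.eq_zero_of_combo s 1 (-t) c d hxy hw (by simp) (by omega) (by omega)
      (by linarith) (by linarith)
    simp [this.1, this.2] at hdet
  rcases le_or_gt s 0 with hs | hs
  · have := h.eq_zero_of_combo t 1 (-s) a b hxy hu (by simp) (by omega) (by omega)
      (by linarith) (by linarith)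
    simp [this.1, this.2] at hdet
  refine hn ?_
  rcases le_total s t with hle | hle
  · exact h.mem_of_combo t 1 (t - s) _ _ hxy hu ht (by simp) (by omega) (by omega)
      (by linear_combination -hx) (by linear_combination -hy)
  · exact h.mem_of_combo s 1 (s - t) _ _ hxy hw hs (by simp) (by omega) (by omega)
      (by linear_combination -hx) (by linear_combination -hy)

end IsCanonicalSet

open MeasureTheory

/-- The closed standard triangle. -/
def stdTriangle : Set (Fin 2 → ℝ) := {z | 0 ≤ z 0 ∧ 0 ≤ z 1 ∧ z 0 + z 1 ≤ 1}

theorem volume_stdTriangle : volume stdTriangle = ENNReal.ofReal (1 / 2) := by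
  set D : Set (ℝ × ℝ) := {p | 0 ≤ p.1 ∧ 0 ≤ p.2 ∧ p.1 + p.2 ≤ 1} with hD
  have hmeas : MeasurableSet D := by
    refine IsClosed.measurableSet ?_
    exact (isClosed_le continuous_const continuous_fst).inter
      ((isClosed_le continuous_const continuous_snd).inter
        (isClosed_le (continuous_fst.add continuous_snd) continuous_const))
  have h₁ : volume stdTriangle = volume D :=
    (volume_preserving_finTwoArrow ℝ).measure_preimage hmeas.nullMeasurableSet
  have h₂ : ∀ x : ℝ, volume (Prod.mk x ⁻¹' D) =
      (Set.Icc (0 : ℝ) 1).indicator (fun x => ENNReal.ofReal (1 - x)) x := by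
    intro x
    by_cases hx : x ∈ Set.Icc (0 : ℝ) 1
    · have : Prod.mk x ⁻¹' D = Set.Icc 0 (1 - x) := by
        ext y
        simp only [hD, Set.mem_preimage, Set.mem_ofPred_eq, Set.mem_Icc]
        constructor
        · rintro ⟨-, h, h'⟩
          exact ⟨h, by linarith⟩
        · rintro ⟨h, h'⟩
          exact ⟨hx.1, h, by linarith⟩
      rw [this, Real.volume_Icc, Set.indicator_of_mem hx, sub_zero]
    · have : Prod.mk x ⁻¹' D = ∅ := by
        ext y
        simp only [hD, Set.mem_preimage, Set.mem_ofPred_eq, Set.mem_empty_iff_false, iff_false]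
        rintro ⟨h, h', h''⟩
        exact hx ⟨h, by linarith⟩
      rw [this, measure_empty, Set.indicator_of_notMem hx]
  rw [h₁, Measure.volume_eq_prod, Measure.prod_apply hmeas]
  simp_rw [h₂]
  rw [lintegral_indicator measurableSet_Icc, ← ofReal_integral_eq_lintegral_ofReal]
  · rw [integral_Icc_eq_integral_Ioc, ← intervalIntegral.integral_of_le zero_le_one]
    congr 1
    rw [intervalIntegral.integral_sub (by simp) (by simp)]
    norm_num
  · exact (continuous_const.sub continuous_id).continuousOn.integrableOn_Icc
  · filter_upwards [ae_restrict_mem measurableSet_Icc] with x hx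
    simpa using hx.2

theorem volume_image_mulVec_add (M : Matrix (Fin 2) (Fin 2) ℝ) (w : Fin 2 → ℝ)
    (s : Set (Fin 2 → ℝ)) :
    volume ((fun x => M.mulVec x + w) '' s) = ENNReal.ofReal |M.det| * volume s := by
  have : (fun x => M.mulVec x + w) '' s = (fun x => x + w) '' (Matrix.toLin' M '' s) := by
    rw [Set.image_image]
    rfl
  rw [this, Set.image_add_right, measure_preimage_add_right, Measure.addHaar_image_linearMap,
    LinearMap.det_toLin']

theorem UnimodEquiv.volume_eq {Q Q' : Set (Fin 2 → ℝ)} (h : UnimodEquiv Q Q') :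
    volume Q' = volume Q := by
  obtain ⟨A, w, hA, rfl⟩ := h
  have hdet : (A.map fun n : ℤ => (n : ℝ)).det = (A.det : ℝ) :=
    ((Int.castRingHom ℝ).map_det A).symm
  have habs : |(A.det : ℝ)| = 1 := by
    rw [← Int.cast_abs, Int.isUnit_iff_abs_eq.1 hA, Int.cast_one]
  rw [volume_image_mulVec_add, hdet, habs, ENNReal.ofReal_one, one_mul]

theorem exists_pos_of_zero_mem_interior {s : Set (Fin 2 → ℝ)}
    (h0 : (0 : Fin 2 → ℝ) ∈ interior (convexHull ℝ s)) {p q : ℝ} (hpq : p ≠ 0 ∨ q ≠ 0) :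
    ∃ v ∈ s, 0 < p * v 0 + q * v 1 := by
  by_contra! hcon
  have hle : ∀ v ∈ convexHull ℝ s, p * v 0 + q * v 1 ≤ 0 := by
    refine convexHull_min (t := {v : Fin 2 → ℝ | p * v 0 + q * v 1 ≤ 0}) hcon ?_
    intro x hx y hy a b ha hb _
    simp only [Set.mem_ofPred_eq, Pi.add_apply, Pi.smul_apply, smul_eq_mul] at hx hy ⊢
    nlinarith [mul_nonneg ha (neg_nonneg.2 hx), mul_nonneg hb (neg_nonneg.2 hy)]
  have hcont : Filter.Tendsto (fun t : ℝ => t • ![p, q]) (nhdsWithin 0 (Set.Ioi 0)) (nhds 0) := by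
    have : Continuous fun t : ℝ => t • ![p, q] := by fun_prop
    simpa using (this.tendsto 0).mono_left nhdsWithin_le_nhds
  obtain ⟨t, ht, htpos⟩ := ((hcont.eventually (mem_interior_iff_mem_nhds.1 h0)).and
    self_mem_nhdsWithin).exists
  have := hle _ ht
  simp only [Pi.smul_apply, smul_eq_mul, Matrix.cons_val_zero, Matrix.cons_val_one] at this
  have hsq : 0 < p * p + q * q := by
    rcases hpq with h | h <;> linarith [mul_self_pos.2 h, mul_self_nonneg p, mul_self_nonneg q]
  have := mul_pos (Set.mem_Ioi.1 htpos) hsq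
  linarith

theorem toR_eq_vecCons (v : Fin 2 → ℤ) : toR v = ![(v 0 : ℝ), (v 1 : ℝ)] := by
  ext i
  fin_cases i <;> rfl

theorem vecCons_eta {α : Type*} (v : Fin 2 → α) : ![v 0, v 1] = v := by
  ext i
  fin_cases i <;> rfl

theorem isCanonicalSet_convexHull {F : Finset (Fin 2 → ℤ)}
    (hzero : (0 : Fin 2 → ℝ) ∈ interior (convexHull ℝ (toR '' (F : Set (Fin 2 → ℤ)))))
    (huniq : ∀ x : Fin 2 → ℤ,
        toR x ∈ interior (convexHull ℝ (toR '' (F : Set (Fin 2 → ℤ)))) → x = 0) :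
    IsCanonicalSet fun a b => toR ![a, b] ∈ convexHull ℝ (toR '' (F : Set (Fin 2 → ℤ))) := by
  set P := convexHull ℝ (toR '' (F : Set (Fin 2 → ℤ))) with hP
  have hconv : Convex ℝ P := convex_convexHull ℝ _
  have h0 : (0 : Fin 2 → ℝ) ∈ P := interior_subset hzero
  have hrepr : ∀ {a b c d m n k x y : ℤ}, 0 < m → m * x = n * a + k * c → m * y = n * b + k * d →
      toR ![x, y] = ((n : ℝ) / m) • toR ![a, b] + ((k : ℝ) / m) • toR ![c, d] := by
    intro a b c d m n k x y hm hx hy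
    have hm' : (m : ℝ) ≠ 0 := by exact_mod_cast hm.ne'
    have hx' : (m : ℝ) * x = n * a + k * c := by exact_mod_cast hx
    have hy' : (m : ℝ) * y = n * b + k * d := by exact_mod_cast hy
    simp only [toR_eq_vecCons]
    ext i
    fin_cases i <;> simp <;> field_simp <;> linarith
  refine ⟨?_, ?_, ?_⟩
  · intro a b c d m n k x y h₁ h₂ hm hn hk hle hx hy
    have hm' : (0 : ℝ) < m := by exact_mod_cast hm
    have hn' : (0 : ℝ) ≤ n := by exact_mod_cast hn
    have hk' : (0 : ℝ) ≤ k := by exact_mod_cast hk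
    have hle' : (n : ℝ) + k ≤ m := by exact_mod_cast hle
    rcases (add_nonneg hn' hk').eq_or_lt with h | h
    · have hn0 : (n : ℝ) = 0 := by linarith
      have hk0 : (k : ℝ) = 0 := by linarith
      rw [hrepr hm hx hy, hn0, hk0]
      simpa using h0
    · have hmem := hconv h₁ h₂ (div_nonneg hn' h.le) (div_nonneg hk' h.le)
        (by field_simp)
      have := hconv.smul_mem_of_zero_mem h0 hmem
        (t := ((n : ℝ) + k) / m) ⟨by positivity, (div_le_one hm').2 hle'⟩
      rw [hrepr hm hx hy]
      convert this using 1
      rw [smul_add, smul_smul, smul_smul]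
      congr 2 <;> field_simp
  · intro a b c d m n k x y h₁ h₂ hn hk hlt hx hy
    have hm : 0 < m := by omega
    have hm' : (0 : ℝ) < m := by exact_mod_cast hm
    have hn' : (0 : ℝ) ≤ n := by exact_mod_cast hn
    have hk' : (0 : ℝ) ≤ k := by exact_mod_cast hk
    have hlt' : (n : ℝ) + k < m := by exact_mod_cast hlt
    have hint : toR ![x, y] ∈ interior P := by
      rcases (add_nonneg hn' hk').eq_or_lt with h | h
      · have hn0 : (n : ℝ) = 0 := by linarith
        have hk0 : (k : ℝ) = 0 := by linarith
        rw [hrepr hm hx hy, hn0, hk0]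
        simpa using hzero
      · have hmem := hconv h₁ h₂ (div_nonneg hn' h.le) (div_nonneg hk' h.le)
          (by field_simp)
        have := hconv.combo_interior_self_mem_interior hzero hmem
          (a := 1 - ((n : ℝ) + k) / m) (b := ((n : ℝ) + k) / m)
          (sub_pos.2 ((div_lt_one hm').2 hlt')) (by positivity) (by ring)
        rw [hrepr hm hx hy]
        convert this using 1
        rw [smul_zero, zero_add, smul_add, smul_smul, smul_smul]
        congr 2 <;> field_simp
    have := huniq _ hint
    exact ⟨congrFun this 0, congrFun this 1⟩
  · intro p q hpq
    obtain ⟨_, ⟨v, hv, rfl⟩, hpos⟩ := exists_pos_of_zero_mem_interior hzero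
      (p := p) (q := q) (by exact_mod_cast hpq)
    refine ⟨v 0, v 1, ?_, ?_⟩
    · rw [vecCons_eta]
      exact subset_convexHull ℝ _ ⟨v, hv, rfl⟩
    · simp only [toR] at hpos
      exact_mod_cast hpos

theorem exists_latticePoints (F : Finset (Fin 2 → ℤ)) :
    ∃ l₀ : Finset (ℤ × ℤ), ∀ v, v ∈ l₀ ↔
      toR ![v.1, v.2] ∈ convexHull ℝ (toR '' (F : Set (Fin 2 → ℤ))) ∧ v ≠ 0 := by
  have hbdd : Bornology.IsBounded (convexHull ℝ (toR '' (F : Set (Fin 2 → ℤ)))) :=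
    isBounded_convexHull.2 (F.finite_toSet.image _).isBounded
  obtain ⟨R, hR⟩ := hbdd.exists_norm_le
  have hfin : {v : ℤ × ℤ | toR ![v.1, v.2] ∈ convexHull ℝ (toR '' (F : Set (Fin 2 → ℤ))) ∧
      v ≠ 0}.Finite := by
    refine (Set.finite_Icc ((-⌈R⌉, -⌈R⌉) : ℤ × ℤ) (⌈R⌉, ⌈R⌉)).subset ?_
    rintro ⟨a, b⟩ ⟨hv, -⟩
    have hle : ∀ i, |toR ![a, b] i| ≤ ⌈R⌉ := fun i =>
      (norm_le_pi_norm (toR ![a, b]) i).trans ((hR _ hv).trans (Int.le_ceil R))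
    have h₁ : |(a : ℝ)| ≤ ⌈R⌉ := hle 0
    have h₂ : |(b : ℝ)| ≤ ⌈R⌉ := hle 1
    rw [← Int.cast_abs, Int.cast_le] at h₁ h₂
    exact ⟨⟨(abs_le.1 h₁).1, (abs_le.1 h₂).1⟩, ⟨(abs_le.1 h₁).2, (abs_le.1 h₂).2⟩⟩
  exact ⟨hfin.toFinset, fun v => by simp⟩

theorem volume_convexHull_le {F : Finset (Fin 2 → ℤ)}
    (hzero : (0 : Fin 2 → ℝ) ∈ interior (convexHull ℝ (toR '' (F : Set (Fin 2 → ℤ)))))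
    (huniq : ∀ x : Fin 2 → ℤ,
        toR x ∈ interior (convexHull ℝ (toR '' (F : Set (Fin 2 → ℤ)))) → x = 0)
    {l₀ : Finset (ℤ × ℤ)} (hl₀ : ∀ v, v ∈ l₀ ↔
      toR ![v.1, v.2] ∈ convexHull ℝ (toR '' (F : Set (Fin 2 → ℤ))) ∧ v ≠ 0) :
    volume (convexHull ℝ (toR '' (F : Set (Fin 2 → ℤ)))) ≤ l₀.card * ENNReal.ofReal (1 / 2) := by
  have hcan := isCanonicalSet_convexHull hzero huniq
  set P := convexHull ℝ (toR '' (F : Set (Fin 2 → ℤ))) with hP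
  have hFP : ∀ v ∈ F, toR ![v 0, v 1] ∈ P := fun v hv => by
    rw [vecCons_eta]
    exact subset_convexHull ℝ _ ⟨v, hv, rfl⟩
  have hnb : ∀ w : l₀, ∃ c d, toR ![c, d] ∈ P ∧ c * w.1.2 - d * w.1.1 = 1 ∧
      toR ![c + w.1.1, d + w.1.2] ∉ P := fun w => by
    obtain ⟨hw, hne⟩ := (hl₀ _).1 w.2
    refine hcan.exists_neighbor hl₀ hw ?_
    by_contra! hcon
    exact hne (Prod.ext hcon.1 hcon.2)
  choose c d hcd hdet hnot using hnb
  set M : l₀ → Matrix (Fin 2) (Fin 2) ℝ := fun w => !![(c w : ℝ), w.1.1; d w, w.1.2] with hM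
  have hMdet : ∀ w, (M w).det = 1 := fun w => by
    rw [hM, Matrix.det_fin_two_of]
    exact_mod_cast (by linarith [hdet w] : c w * w.1.2 - w.1.1 * d w = 1)
  have hcover : P ⊆ ⋃ w : l₀, (fun x => (M w).mulVec x + 0) '' stdTriangle := by
    intro x hx
    obtain ⟨w, hw₁, hw₂⟩ : ∃ w : l₀, 0 ≤ x 0 * w.1.2 - x 1 * w.1.1 ∧ 0 ≤ c w * x 1 - d w * x 0 := by
      have hmem : ∀ v ∈ F, ∀ p q : ℝ, 0 < p * toR v 0 + q * toR v 1 → (v 0, v 1) ∈ l₀ := by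
        intro v hv p q hpos
        refine (hl₀ _).2 ⟨hFP v hv, fun h => ?_⟩
        simp only [Prod.mk_eq_zero] at h
        simp [toR, h.1, h.2] at hpos
      by_cases hx0 : x 0 = 0 ∧ x 1 = 0
      · obtain ⟨_, ⟨v, hv, rfl⟩, hpos⟩ := exists_pos_of_zero_mem_interior hzero
          (p := 1) (q := 0) (by simp)
        exact ⟨⟨_, hmem v hv _ _ hpos⟩, by simp [hx0.1, hx0.2], by simp [hx0.1, hx0.2]⟩
      have hx0' : x 0 ≠ 0 ∨ x 1 ≠ 0 := by tauto
      obtain ⟨_, ⟨v, hv, rfl⟩, hpos⟩ := exists_pos_of_zero_mem_interior hzero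
        (p := -x 1) (q := x 0) (by simpa using hx0'.symm)
      obtain ⟨w, hw, hmax⟩ := Finset.exists_max_image
        (l₀.filter fun v => 0 < x 0 * v.2 - x 1 * v.1)
        (fun v => (x 0 * v.1 + x 1 * v.2) / (x 0 * v.2 - x 1 * v.1))
        ⟨(v 0, v 1), Finset.mem_filter.2 ⟨hmem v hv _ _ hpos, by simp [toR] at hpos ⊢; linarith⟩⟩
      rw [Finset.mem_filter] at hw
      refine ⟨⟨w, hw.1⟩, hw.2.le, ?_⟩
      by_contra! hneg
      set u := c ⟨w, hw.1⟩ with hu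
      set t := d ⟨w, hw.1⟩ with ht
      have hdet' : (u : ℝ) * w.2 - t * w.1 = 1 := by exact_mod_cast hdet ⟨w, hw.1⟩
      have hul : (u, t) ∈ l₀ := (hl₀ _).2 ⟨hcd ⟨w, hw.1⟩, fun h => by
        simp only [Prod.mk_eq_zero] at h
        simp [h.1, h.2] at hdet'⟩
      have hpos' : 0 < x 0 * t - x 1 * u := by linarith
      have := hmax (u, t) (Finset.mem_filter.2 ⟨hul, hpos'⟩)
      simp only at this
      rw [div_le_div_iff₀ hpos' hw.2] at this
      have hsq : 0 < x 0 * x 0 + x 1 * x 1 := by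
        rcases hx0' with h | h <;>
          linarith [mul_self_pos.2 h, mul_self_nonneg (x 0), mul_self_nonneg (x 1)]
      have hid : (x 0 * u + x 1 * t) * (x 0 * w.2 - x 1 * w.1) -
          (x 0 * w.1 + x 1 * w.2) * (x 0 * t - x 1 * u) = x 0 * x 0 + x 1 * x 1 := by
        linear_combination (x 0 * x 0 + x 1 * x 1) * hdet'
      linarith
    have hdet' : (c w : ℝ) * w.1.2 - d w * w.1.1 = 1 := by exact_mod_cast hdet w
    have hle : (x 0 * w.1.2 - x 1 * w.1.1) + (c w * x 1 - d w * x 0) ≤ 1 := by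
      refine convexHull_min (t := {x : Fin 2 → ℝ |
        (x 0 * w.1.2 - x 1 * w.1.1) + (c w * x 1 - d w * x 0) ≤ 1}) ?_ ?_ hx
      · rintro _ ⟨v, hv, rfl⟩
        have := hcan.sum_coords_le_one ((hl₀ _).1 w.2).1 (hcd w) (hdet w) (hnot w) (hFP v hv)
        simp only [toR, Set.mem_ofPred_eq]
        exact_mod_cast this
      · intro y hy z hz α β hα hβ hαβ
        simp only [Set.mem_ofPred_eq, Pi.add_apply, Pi.smul_apply, smul_eq_mul] at hy hz ⊢
        nlinarith [mul_le_mul_of_nonneg_left hy hα, mul_le_mul_of_nonneg_left hz hβ]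
    refine Set.mem_iUnion.2 ⟨w, ![x 0 * w.1.2 - x 1 * w.1.1, c w * x 1 - d w * x 0],
      ⟨by simpa using hw₁, by simpa using hw₂, by simpa using hle⟩, ?_⟩
    ext i
    fin_cases i
    · simp [hM]
      linear_combination x 0 * hdet'
    · simp [hM]
      linear_combination x 1 * hdet'
  refine (measure_mono hcover).trans ((measure_iUnion_fintype_le _ _).trans (le_of_eq ?_))
  simp only [volume_image_mulVec_add, hMdet, volume_stdTriangle]
  simp

theorem convexHull_triangle_eq :
    convexHull ℝ ({toR ![(-1 : ℤ), -1], toR ![(2 : ℤ), -1], toR ![(-1 : ℤ), 2]} :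
        Set (Fin 2 → ℝ)) = {x | -1 ≤ x 0 ∧ -1 ≤ x 1 ∧ x 0 + x 1 ≤ 1} := by
  refine (convexHull_min ?_ ?_).antisymm fun x ⟨h₀, h₁, h₂⟩ => ?_
  · rintro x (rfl | rfl | rfl) <;> simp [toR] <;> norm_num
  · intro x hx y hy a b ha hb hab
    simp only [Set.mem_ofPred_eq, Pi.add_apply, Pi.smul_apply, smul_eq_mul] at hx hy ⊢
    obtain rfl : b = 1 - a := by linarith
    exact ⟨by nlinarith, by nlinarith, by nlinarith⟩
  · have hx : x = ∑ i, ![(1 - x 0 - x 1) / 3, (x 0 + 1) / 3, (x 1 + 1) / 3] i •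
        ![toR ![(-1 : ℤ), -1], toR ![(2 : ℤ), -1], toR ![(-1 : ℤ), 2]] i := by
      ext j
      fin_cases j <;> simp [Fin.sum_univ_three, toR] <;> ring
    rw [hx]
    refine (convex_convexHull ℝ _).sum_mem (fun i _ => ?_) ?_ fun i _ => subset_convexHull ℝ _ ?_
    · fin_cases i <;> simp <;> linarith
    · simp [Fin.sum_univ_three]
      ring
    · fin_cases i <;> simp

theorem volume_convexHull_triangle :
    volume (convexHull ℝ ({toR ![(-1 : ℤ), -1], toR ![(2 : ℤ), -1], toR ![(-1 : ℤ), 2]} :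
        Set (Fin 2 → ℝ))) = ENNReal.ofReal (9 / 2) := by
  have h : convexHull ℝ ({toR ![(-1 : ℤ), -1], toR ![(2 : ℤ), -1], toR ![(-1 : ℤ), 2]} :
      Set (Fin 2 → ℝ)) =
      (fun x => (!![3, 0; 0, 3] : Matrix (Fin 2) (Fin 2) ℝ).mulVec x + ![-1, -1]) ''
        stdTriangle := by
    rw [convexHull_triangle_eq]
    ext x
    constructor
    · rintro ⟨h₀, h₁, h₂⟩
      refine ⟨![(x 0 + 1) / 3, (x 1 + 1) / 3], ⟨?_, ?_, ?_⟩, ?_⟩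
      · simp
        linarith
      · simp
        linarith
      · simp
        linarith
      · ext i
        fin_cases i <;> simp
    · rintro ⟨z, ⟨h₀, h₁, h₂⟩, rfl⟩
      have h₃ : 3 * z 0 + -1 + (3 * z 1 + -1) ≤ 1 := by linarith
      simpa using ⟨h₀, h₁, h₃⟩
  rw [h, volume_image_mulVec_add, volume_stdTriangle, Matrix.det_fin_two_of,
    ← ENNReal.ofReal_mul (abs_nonneg _)]
  norm_num

theorem unimodEquiv_triangle {F : Finset (Fin 2 → ℤ)} {p q r s : ℤ} (hdet : p * s - q * r = 1)
    (h₁ : toR ![p * -1 + q * -1, r * -1 + s * -1] ∈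
      convexHull ℝ (toR '' (F : Set (Fin 2 → ℤ))))
    (h₂ : toR ![p * 2 + q * -1, r * 2 + s * -1] ∈ convexHull ℝ (toR '' (F : Set (Fin 2 → ℤ))))
    (h₃ : toR ![p * -1 + q * 2, r * -1 + s * 2] ∈ convexHull ℝ (toR '' (F : Set (Fin 2 → ℤ))))
    (hsub : ∀ a b, toR ![p * a + q * b, r * a + s * b] ∈
      convexHull ℝ (toR '' (F : Set (Fin 2 → ℤ))) → -1 ≤ a ∧ -1 ≤ b ∧ a + b ≤ 1) :
    UnimodEquiv (convexHull ℝ (toR '' (F : Set (Fin 2 → ℤ))))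
      (convexHull ℝ ({toR ![(-1 : ℤ), -1], toR ![(2 : ℤ), -1], toR ![(-1 : ℤ), 2]} :
        Set (Fin 2 → ℝ))) := by
  refine ⟨!![s, -q; -r, p], 0, ?_, ?_⟩
  · rw [Matrix.det_fin_two_of, show s * p - -q * -r = 1 by linear_combination hdet]
    exact isUnit_one
  have hdet' : (p : ℝ) * s - q * r = 1 := by exact_mod_cast hdet
  set P := convexHull ℝ (toR '' (F : Set (Fin 2 → ℤ))) with hP
  have hfun : (fun x => ((!![s, -q; -r, p] : Matrix (Fin 2) (Fin 2) ℤ).map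
      fun n : ℤ => (n : ℝ)).mulVec x + toR 0) =
      fun x : Fin 2 → ℝ => ![s * x 0 - q * x 1, p * x 1 - r * x 0] := by
    ext x i
    fin_cases i <;> simp [toR] <;> ring
  rw [hfun]
  refine (convexHull_min ?_ ?_).antisymm ?_
  · rintro x (rfl | rfl | rfl)
    · refine ⟨_, h₁, ?_⟩
      ext i
      fin_cases i <;> simp [toR] <;> linear_combination -hdet'
    · refine ⟨_, h₂, ?_⟩
      ext i
      fin_cases i <;> simp [toR]
      · linear_combination 2 * hdet'
      · linear_combination -hdet'
    · refine ⟨_, h₃, ?_⟩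
      ext i
      fin_cases i <;> simp [toR]
      · linear_combination -hdet'
      · linear_combination 2 * hdet'
  · refine (convex_convexHull ℝ _).is_linear_image ⟨fun x y => ?_, fun c x => ?_⟩ <;> ext i <;>
      fin_cases i <;> simp <;> ring
  · rw [Set.image_subset_iff, convexHull_triangle_eq]
    refine convexHull_min ?_ ?_
    · rintro _ ⟨v, hv, rfl⟩
      have := hsub (s * v 0 - q * v 1) (p * v 1 - r * v 0) (by
        have he : ![p * (s * v 0 - q * v 1) + q * (p * v 1 - r * v 0),
            r * (s * v 0 - q * v 1) + s * (p * v 1 - r * v 0)] = v := by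
          ext i
          fin_cases i <;> simp
          · linear_combination v 0 * hdet
          · linear_combination v 1 * hdet
        rw [he]
        exact subset_convexHull ℝ _ ⟨v, hv, rfl⟩)
      simp only [toR, Set.mem_preimage, Set.mem_ofPred_eq, Matrix.cons_val_zero,
        Matrix.cons_val_one]
      exact_mod_cast this
    · intro x hx y hy a b ha hb hab
      simp only [Set.mem_preimage, Set.mem_ofPred_eq, Matrix.cons_val_zero,
        Matrix.cons_val_one, Pi.add_apply, Pi.smul_apply, smul_eq_mul] at hx hy ⊢
      obtain rfl : b = 1 - a := by linarith
      refine ⟨?_, ?_, ?_⟩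
      · linarith [mul_le_mul_of_nonneg_left hx.1 ha, mul_le_mul_of_nonneg_left hy.1 hb]
      · linarith [mul_le_mul_of_nonneg_left hx.2.1 ha, mul_le_mul_of_nonneg_left hy.2.1 hb]
      · linarith [mul_le_mul_of_nonneg_left hx.2.2 ha, mul_le_mul_of_nonneg_left hy.2.2 hb]

/-- A two-dimensional lattice polytope whose only interior lattice point is the origin
has normalized volume at most `9`, with equality iff it is unimodularly equivalent to
`conv{0, 3e_1, 3e_2} - (1,1)`. -/
theorem canonical_polygon_volume (F : Finset (Fin 2 → ℤ))
    (hzero : (0 : Fin 2 → ℝ) ∈ interior (convexHull ℝ (toR '' (F : Set (Fin 2 → ℤ)))))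
    (huniq : ∀ x : Fin 2 → ℤ,
        toR x ∈ interior (convexHull ℝ (toR '' (F : Set (Fin 2 → ℤ)))) → x = 0) :
    2 * (MeasureTheory.volume (convexHull ℝ (toR '' (F : Set (Fin 2 → ℤ))))).toReal ≤ 9 ∧
      (2 * (MeasureTheory.volume (convexHull ℝ (toR '' (F : Set (Fin 2 → ℤ))))).toReal = 9 ↔
        UnimodEquiv (convexHull ℝ (toR '' (F : Set (Fin 2 → ℤ))))
          (convexHull ℝ
            ({toR ![(-1 : ℤ), -1], toR ![(2 : ℤ), -1], toR ![(-1 : ℤ), 2]} :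
              Set (Fin 2 → ℝ)))) := by
  have hcan := isCanonicalSet_convexHull hzero huniq
  obtain ⟨l₀, hl₀⟩ := exists_latticePoints F
  have hequiv : UnimodEquiv (convexHull ℝ (toR '' (F : Set (Fin 2 → ℤ))))
      (convexHull ℝ ({toR ![(-1 : ℤ), -1], toR ![(2 : ℤ), -1], toR ![(-1 : ℤ), 2]} :
        Set (Fin 2 → ℝ))) →
      2 * (volume (convexHull ℝ (toR '' (F : Set (Fin 2 → ℤ))))).toReal = 9 := by
    intro h
    rw [← h.volume_eq, volume_convexHull_triangle, ENNReal.toReal_ofReal (by norm_num)]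
    norm_num
  rcases hcan.classification hl₀ with hcard | ⟨p, q, r, s, hdet, h₁, h₂, h₃, hsub⟩
  · have hle : (volume (convexHull ℝ (toR '' (F : Set (Fin 2 → ℤ))))).toReal ≤
        l₀.card * (1 / 2) := by
      have := ENNReal.toReal_mono (by finiteness) (volume_convexHull_le hzero huniq hl₀)
      rwa [ENNReal.toReal_mul, ENNReal.toReal_natCast, ENNReal.toReal_ofReal (by norm_num)] at this
    have hcard' : (l₀.card : ℝ) ≤ 8 := by exact_mod_cast hcard
    exact ⟨by linarith, fun h => by linarith, hequiv⟩
  · have h := unimodEquiv_triangle hdet h₁ h₂ h₃ hsub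
    exact ⟨(hequiv h).le, fun _ => h, hequiv⟩
end
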